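/- arXiv:1412.0222 — 2 statements merged into one kernel-verified Lean document; each statement's English description precedes it below -/
import Mathlib

section
/- (Xu's uniform convexity of H_p for 0<p≤2, matrix version.) For each 0<p≤2 there is a constant δ_p > 0, depending only on p, such that for every n and every function F continuous on the closed unit disc of ℂ with values in M_n(ℂ) and analytic on the open unit disc: ‖F(0)‖_p^2 + δ_p ((1/2π)∫_0^{2π} ‖F(e^{it}) − F(0)‖_p^p dt)^{2/p} ≤ ((1/2π)∫_0^{2π} ‖F(e^{it})‖_p^p dt)^{2/p}. -/
open scoped BigOperators
open Matrix MeasureTheory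
attribute [local instance] Matrix.frobeniusNormedAddCommGroup Matrix.frobeniusNormedSpace

open scoped ComplexOrder

/-- `A^β` for a Hermitian (in practice positive semidefinite) matrix `A`, via the
spectral functional calculus (with the conventions of `Real.rpow` on eigenvalues,
in particular `0 ^ β = 0` for `β ≠ 0`), extended by `0` to non-Hermitian matrices. -/
noncomputable def posPow {ι : Type*} [Fintype ι] [DecidableEq ι]
    (A : Matrix ι ι ℂ) (β : ℝ) : Matrix ι ι ℂ :=
  if hA : A.IsHermitian then hA.cfc (fun t => t ^ β) else 0

/-- Schatten `p`-(quasi)norm of a complex matrix: `(Tr((A*A)^(p/2)))^(1/p)`. -/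
noncomputable def schattenNorm {ι : Type*} [Fintype ι] [DecidableEq ι]
    (p : ℝ) (A : Matrix ι ι ℂ) : ℝ :=
  ((posPow (Aᴴ * A) (p / 2)).trace.re) ^ (1 / p)

/-- Operator norm of a matrix, acting on the Euclidean space. -/
noncomputable def opNorm {ι : Type*} [Fintype ι] [DecidableEq ι]
    (A : Matrix ι ι ℂ) : ℝ :=
  ‖Matrix.toEuclideanCLM (𝕜 := ℂ) A‖

/-- The quantity `|||x|||_p` for `0 < p ≤ 2`: the infimum of
`‖(∑ aₖ*aₖ)^(1/2)‖_p + ‖(∑ bₖbₖ*)^(1/2)‖_p` over decompositions `xₖ = aₖ + bₖ`. -/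
noncomputable def tripleNorm {n N : ℕ} (p : ℝ)
    (x : Fin N → Matrix (Fin n) (Fin n) ℂ) : ℝ :=
  sInf { r : ℝ | ∃ a b : Fin N → Matrix (Fin n) (Fin n) ℂ,
    (∀ k, x k = a k + b k) ∧
    r = schattenNorm p (posPow (∑ k, (a k)ᴴ * a k) (1/2))
        + schattenNorm p (posPow (∑ k, b k * (b k)ᴴ) (1/2)) }

/-- `E_ε ‖∑ ε_k x_k‖_p ^ p`, the average over a uniformly random choice of signs. -/
noncomputable def radAvg {n N : ℕ} (p : ℝ)
    (x : Fin N → Matrix (Fin n) (Fin n) ℂ) : ℝ :=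
  (1 / 2 ^ N) * ∑ ε : Fin N → Bool,
    (schattenNorm p (∑ k, (if ε k then (1 : ℂ) else -1) • x k)) ^ p

section TracePower

variable {ι : Type*} [Fintype ι] [DecidableEq ι]

/-- The sum of the `t`-th powers of the (real parts of the) eigenvalues of `X`; for positive
semidefinite `X` this is `Tr (X ^ t)`. -/
noncomputable def tracePow (t : ℝ) (X : Matrix ι ι ℂ) : ℝ :=
  (X.charpoly.roots.map fun z => z.re ^ t).sum

lemma roots_charpoly_conj_diagonal {U V X : Matrix ι ι ℂ} {d : ι → ℝ} (h : V * U = 1)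
    (hX : X = U * diagonal (fun i => (d i : ℂ)) * V) :
    X.charpoly.roots = Finset.univ.val.map fun i => (d i : ℂ) := by
  rw [hX, charpoly_mul_comm, ← mul_assoc, h, one_mul, charpoly_diagonal]
  rw [← Polynomial.roots_multiset_prod_X_sub_C (Finset.univ.val.map fun i => (d i : ℂ)),
    Multiset.map_map]
  rfl

lemma tracePow_conj_diagonal {U V X : Matrix ι ι ℂ} {d : ι → ℝ} (h : V * U = 1)
    (hX : X = U * diagonal (fun i => (d i : ℂ)) * V) (t : ℝ) :
    tracePow t X = ∑ i, d i ^ t := by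
  rw [tracePow, roots_charpoly_conj_diagonal h hX, Multiset.map_map]
  rfl

lemma Matrix.IsHermitian.exists_conj_diagonal {X : Matrix ι ι ℂ} (hX : X.IsHermitian) :
    ∃ (U : Matrix ι ι ℂ) (d : ι → ℝ), Uᴴ * U = 1 ∧ U * Uᴴ = 1 ∧
      X = U * diagonal (fun i => (d i : ℂ)) * Uᴴ ∧
      ∀ f : ℝ → ℝ, hX.cfc f = U * diagonal (fun i => (f (d i) : ℂ)) * Uᴴ := by
  refine ⟨hX.eigenvectorUnitary, hX.eigenvalues, ?_, ?_, ?_, ?_⟩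
  · exact Unitary.coe_star_mul_self hX.eigenvectorUnitary
  · exact Unitary.coe_mul_star_self hX.eigenvectorUnitary
  · conv_lhs => rw [hX.spectral_theorem]
    rfl
  · intro f
    rfl

lemma nonneg_of_conj_diagonal {U X : Matrix ι ι ℂ} {d : ι → ℝ} (h : Uᴴ * U = 1)
    (hX : X = U * diagonal (fun i => (d i : ℂ)) * Uᴴ) (hp : X.PosSemidef) (i : ι) : 0 ≤ d i := by
  have h1 : Uᴴ * X * U = diagonal (fun i => (d i : ℂ)) := by
    rw [hX]
    calc _ = (Uᴴ * U) * diagonal (fun i => (d i : ℂ)) * (Uᴴ * U) := by simp only [mul_assoc]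
      _ = _ := by rw [h, one_mul, mul_one]
  have h2 := hp.conjTranspose_mul_mul_same U
  rw [h1] at h2
  have := h2.diag_nonneg (i := i)
  simpa using this

lemma Matrix.PosSemidef.exists_conj_diagonal {X : Matrix ι ι ℂ} (hX : X.PosSemidef) :
    ∃ (U : Matrix ι ι ℂ) (d : ι → ℝ), Uᴴ * U = 1 ∧ U * Uᴴ = 1 ∧ (∀ i, 0 ≤ d i) ∧
      X = U * diagonal (fun i => (d i : ℂ)) * Uᴴ := by
  obtain ⟨U, d, h1, h2, h3, -⟩ := hX.isHermitian.exists_conj_diagonal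
  exact ⟨U, d, h1, h2, nonneg_of_conj_diagonal h1 h3 hX, h3⟩

lemma posSemidef_conj_diagonal {U X : Matrix ι ι ℂ} {d : ι → ℝ} (hd : ∀ i, 0 ≤ d i)
    (hX : X = U * diagonal (fun i => (d i : ℂ)) * Uᴴ) : X.PosSemidef := by
  rw [hX]
  refine PosSemidef.mul_mul_conjTranspose_same ?_ U
  refine PosSemidef.diagonal fun i => ?_
  simpa using hd i

lemma tracePow_nonneg (t : ℝ) {X : Matrix ι ι ℂ} (hX : X.PosSemidef) : 0 ≤ tracePow t X := by
  obtain ⟨U, d, h1, -, h3, h4⟩ := hX.exists_conj_diagonal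
  rw [tracePow_conj_diagonal h1 h4]
  exact Finset.sum_nonneg fun i _ => Real.rpow_nonneg (h3 i) _

lemma trace_posPow {X : Matrix ι ι ℂ} (hX : X.IsHermitian) (t : ℝ) :
    (posPow X t).trace.re = tracePow t X := by
  obtain ⟨U, d, h1, h2, h3, h4⟩ := hX.exists_conj_diagonal
  rw [tracePow_conj_diagonal h1 h3, posPow, dif_pos hX, h4, trace_mul_comm, ← mul_assoc, h1,
    one_mul, trace_diagonal]
  simp only [Complex.re_sum, Complex.ofReal_re]

lemma tracePow_mul_comm (t : ℝ) (X Y : Matrix ι ι ℂ) :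
    tracePow t (X * Y) = tracePow t (Y * X) := by
  rw [tracePow, charpoly_mul_comm, tracePow]

lemma tracePow_reindex {κ : Type*} [Fintype κ] [DecidableEq κ] (e : ι ≃ κ) (t : ℝ)
    (X : Matrix ι ι ℂ) : tracePow t (reindex e e X) = tracePow t X := by
  rw [tracePow, charpoly_reindex, tracePow]

lemma tracePow_one {X : Matrix ι ι ℂ} (hX : X.IsHermitian) : tracePow 1 X = X.trace.re := by
  obtain ⟨U, d, h1, h2, h3, h4⟩ := hX.exists_conj_diagonal
  rw [tracePow_conj_diagonal h1 h3, h3, trace_mul_comm, ← mul_assoc, h1,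
    one_mul, trace_diagonal]
  simp only [Complex.re_sum, Complex.ofReal_re, Real.rpow_one]

lemma tracePow_smul {X : Matrix ι ι ℂ} (hX : X.PosSemidef) {c : ℝ} (hc : 0 ≤ c) (t : ℝ) :
    tracePow t ((c : ℂ) • X) = c ^ t * tracePow t X := by
  obtain ⟨U, d, h1, -, h3, h4⟩ := hX.exists_conj_diagonal
  have h5 : (c : ℂ) • X = U * diagonal (fun i => ((c * d i : ℝ) : ℂ)) * Uᴴ := by
    rw [h4, ← smul_mul_assoc, ← mul_smul_comm, ← diagonal_smul]
    congr 3
    ext i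
    simp
  rw [tracePow_conj_diagonal h1 h4, tracePow_conj_diagonal h1 h5, Finset.mul_sum]
  exact Finset.sum_congr rfl fun i _ => Real.mul_rpow hc (h3 i)

end TracePower

section TraceInequalities

/-- Hölder's inequality for a doubly substochastic array. -/
lemma sum_rpow_le_of_doubly_stochastic {ι κ : Type*} [Fintype ι] [Fintype κ] {m : ι → κ → ℝ}
    (hm : ∀ i j, 0 ≤ m i j) (hrow : ∀ i, ∑ j, m i j = 1) (hcol : ∀ j, ∑ i, m i j = 1)
    {x : ι → ℝ} (hx : ∀ i, 0 ≤ x i) {y : κ → ℝ} (hy : ∀ j, 0 < y j) {t : ℝ} (ht0 : 0 < t)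
    (ht1 : t ≤ 1) :
    ∑ i, x i ^ t ≤ (∑ j, (∑ i, m i j * x i) * y j ^ (t - 1)) ^ t * (∑ j, y j ^ t) ^ (1 - t) := by
  rcases ht1.eq_or_lt with rfl | ht1
  · simp only [Real.rpow_one, sub_self, Real.rpow_zero, mul_one]
    rw [Finset.sum_comm]
    refine Finset.sum_le_sum fun i _ => ?_
    rw [← Finset.sum_mul, hrow, one_mul]
  have ht1' : 0 < 1 - t := by linarith
  have hpq : (1 / t).HolderConjugate (1 / (1 - t)) := by
    rw [Real.holderConjugate_iff]
    constructor
    · rw [lt_div_iff₀ ht0]; linarith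
    · simp
  have key := Real.inner_le_Lp_mul_Lq_of_nonneg (Finset.univ : Finset (ι × κ)) hpq
    (f := fun q => (m q.1 q.2 * x q.1 * y q.2 ^ (t - 1)) ^ t)
    (g := fun q => (m q.1 q.2 * y q.2 ^ t) ^ (1 - t))
    (fun q _ => Real.rpow_nonneg (mul_nonneg (mul_nonneg (hm _ _) (hx _))
      (Real.rpow_nonneg (hy _).le _)) _)
    (fun q _ => Real.rpow_nonneg (mul_nonneg (hm _ _) (Real.rpow_nonneg (hy _).le _)) _)
  have e1 : ∀ q : ι × κ, (m q.1 q.2 * x q.1 * y q.2 ^ (t - 1)) ^ t *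
      (m q.1 q.2 * y q.2 ^ t) ^ (1 - t) = m q.1 q.2 * x q.1 ^ t := by
    intro q
    have hy' := hy q.2
    rw [Real.mul_rpow (mul_nonneg (hm _ _) (hx _)) (Real.rpow_nonneg hy'.le _),
      Real.mul_rpow (hm _ _) (hx _), Real.mul_rpow (hm _ _) (Real.rpow_nonneg hy'.le _),
      ← Real.rpow_mul hy'.le, ← Real.rpow_mul hy'.le]
    have h1 : m q.1 q.2 ^ t * m q.1 q.2 ^ (1 - t) = m q.1 q.2 := by
      rw [← Real.rpow_add' (hm _ _) (by simp)]; simp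
    have h2 : y q.2 ^ ((t - 1) * t) * y q.2 ^ (t * (1 - t)) = 1 := by
      rw [← Real.rpow_add hy']; ring_nf; simp
    calc _ = (m q.1 q.2 ^ t * m q.1 q.2 ^ (1 - t)) * x q.1 ^ t *
        (y q.2 ^ ((t - 1) * t) * y q.2 ^ (t * (1 - t))) := by ring
      _ = _ := by rw [h1, h2, mul_one]
  have e2 : ∀ q : ι × κ, ((m q.1 q.2 * x q.1 * y q.2 ^ (t - 1)) ^ t) ^ (1 / t) =
      m q.1 q.2 * x q.1 * y q.2 ^ (t - 1) := by
    intro q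
    rw [← Real.rpow_mul (mul_nonneg (mul_nonneg (hm _ _) (hx _))
      (Real.rpow_nonneg (hy _).le _)), mul_one_div_cancel ht0.ne', Real.rpow_one]
  have e3 : ∀ q : ι × κ, ((m q.1 q.2 * y q.2 ^ t) ^ (1 - t)) ^ (1 / (1 - t)) =
      m q.1 q.2 * y q.2 ^ t := by
    intro q
    rw [← Real.rpow_mul (mul_nonneg (hm _ _) (Real.rpow_nonneg (hy _).le _)),
      mul_one_div_cancel ht1'.ne', Real.rpow_one]
  simp only [e1, e2, e3, one_div_one_div] at key
  have f1 : ∑ q : ι × κ, m q.1 q.2 * x q.1 ^ t = ∑ i, x i ^ t := by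
    rw [Fintype.sum_prod_type]
    refine Finset.sum_congr rfl fun i _ => ?_
    simp only
    rw [← Finset.sum_mul, hrow, one_mul]
  have f2 : ∑ q : ι × κ, m q.1 q.2 * x q.1 * y q.2 ^ (t - 1) =
      ∑ j, (∑ i, m i j * x i) * y j ^ (t - 1) := by
    rw [Fintype.sum_prod_type_right]
    refine Finset.sum_congr rfl fun j _ => ?_
    rw [Finset.sum_mul]
  have f3 : ∑ q : ι × κ, m q.1 q.2 * y q.2 ^ t = ∑ j, y j ^ t := by
    rw [Fintype.sum_prod_type_right]
    refine Finset.sum_congr rfl fun j _ => ?_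
    simp only
    rw [← Finset.sum_mul, hcol, one_mul]
  rwa [f1, f2, f3] at key

lemma tendsto_sum_add_rpow {ι : Type*} [Fintype ι] (z : ι → ℝ) {t : ℝ} (ht0 : 0 < t) :
    Filter.Tendsto (fun ε : ℝ => ∑ j, (z j + ε) ^ t) (nhdsWithin 0 (Set.Ioi 0))
      (nhds (∑ j, z j ^ t)) := by
  have : Continuous (fun ε : ℝ => ∑ j, (z j + ε) ^ t) :=
    continuous_finsetSum _ fun j _ =>
      (continuous_const.add continuous_id).rpow_const fun _ => Or.inr ht0.le
  simpa using (this.tendsto 0).mono_left nhdsWithin_le_nhds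

variable {ι : Type*} [Fintype ι] [DecidableEq ι]

lemma sum_normSq_row {W : Matrix ι ι ℂ} (h : W * Wᴴ = 1) (i : ι) :
    ∑ j, Complex.normSq (W i j) = 1 := by
  have := congrArg Complex.re (congrFun (congrFun h i) i)
  rw [mul_apply, Complex.re_sum] at this
  simpa [Complex.mul_conj] using this

lemma sum_normSq_col {W : Matrix ι ι ℂ} (h : Wᴴ * W = 1) (j : ι) :
    ∑ i, Complex.normSq (W i j) = 1 := by
  have := congrArg Complex.re (congrFun (congrFun h j) j)
  rw [mul_apply, Complex.re_sum] at this
  simpa [mul_comm, Complex.mul_conj] using this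

lemma conj_conj_eq {U V X : Matrix ι ι ℂ} {x : ι → ℝ}
    (hX : X = U * diagonal (fun i => (x i : ℂ)) * Uᴴ) :
    Vᴴ * X * V = (Uᴴ * V)ᴴ * diagonal (fun i => (x i : ℂ)) * (Uᴴ * V) := by
  rw [hX, conjTranspose_mul, conjTranspose_conjTranspose]
  simp only [mul_assoc]

lemma conj_diagonal_diag_re (W : Matrix ι ι ℂ) (x : ι → ℝ) (j : ι) :
    ((Wᴴ * diagonal (fun i => (x i : ℂ)) * W) j j).re = ∑ i, Complex.normSq (W i j) * x i := by
  rw [mul_apply, Complex.re_sum]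
  refine Finset.sum_congr rfl fun i _ => ?_
  rw [mul_diagonal, conjTranspose_apply]
  simp [Complex.normSq_apply]
  ring

lemma unitary_conj_mul {U V : Matrix ι ι ℂ} (hU : U * Uᴴ = 1) (hV : Vᴴ * V = 1) :
    (Uᴴ * V)ᴴ * (Uᴴ * V) = 1 := by
  rw [conjTranspose_mul, conjTranspose_conjTranspose]
  calc Vᴴ * U * (Uᴴ * V) = Vᴴ * (U * Uᴴ) * V := by simp only [mul_assoc]
    _ = 1 := by rw [hU, mul_one, hV]

lemma unitary_conj_mul' {U V : Matrix ι ι ℂ} (hU : Uᴴ * U = 1) (hV : V * Vᴴ = 1) :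
    (Uᴴ * V) * (Uᴴ * V)ᴴ = 1 := by
  rw [conjTranspose_mul, conjTranspose_conjTranspose]
  calc Uᴴ * V * (Vᴴ * U) = Uᴴ * (V * Vᴴ) * U := by simp only [mul_assoc]
    _ = 1 := by rw [hV, mul_one, hU]

/-- `Tr X^t ≤ (Tr X Y^(t-1))^t (Tr Y^t)^(1-t)`, where `Y` is given by its eigenvectors (the
columns of `V`) and its eigenvalues `y`. -/
lemma tracePow_le_holder {X V : Matrix ι ι ℂ} (hX : X.PosSemidef) (hV : Vᴴ * V = 1)
    (hV' : V * Vᴴ = 1) {y : ι → ℝ} (hy : ∀ j, 0 < y j) {t : ℝ} (ht0 : 0 < t) (ht1 : t ≤ 1) :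
    tracePow t X ≤ (∑ j, ((Vᴴ * X * V) j j).re * y j ^ (t - 1)) ^ t *
      (∑ j, y j ^ t) ^ (1 - t) := by
  obtain ⟨U, x, h1, h2, h3, h4⟩ := hX.exists_conj_diagonal
  rw [tracePow_conj_diagonal h1 h4]
  simp only [conj_conj_eq h4, conj_diagonal_diag_re]
  exact sum_rpow_le_of_doubly_stochastic (fun _ _ => Complex.normSq_nonneg _)
    (sum_normSq_row (unitary_conj_mul' h1 hV')) (sum_normSq_col (unitary_conj_mul h2 hV))
    h3 hy ht0 ht1

/-- `X ≤ Z` implies `Tr X^t ≥ Tr X (Z + ε)^(t-1)`. -/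
lemma sum_diag_mul_rpow_le_tracePow {X Z V : Matrix ι ι ℂ} (hX : X.PosSemidef) (hV : Vᴴ * V = 1)
    (hV' : V * Vᴴ = 1) {z : ι → ℝ} (hz : ∀ j, 0 ≤ z j)
    (hZ : Z = V * diagonal (fun i => (z i : ℂ)) * Vᴴ) (hXZ : (Z - X).PosSemidef)
    {ε : ℝ} (hε : 0 < ε) {t : ℝ} (ht0 : 0 < t) (ht1 : t ≤ 1) :
    ∑ j, ((Vᴴ * X * V) j j).re * (z j + ε) ^ (t - 1) ≤ tracePow t X := by
  obtain ⟨U, x, h1, h2, h3, h4⟩ := hX.exists_conj_diagonal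
  rw [tracePow_conj_diagonal h1 h4]
  simp only [conj_conj_eq h4, conj_diagonal_diag_re]
  have hW1 := unitary_conj_mul h2 hV
  have hW2 := unitary_conj_mul' h1 hV'
  have hUX : Uᴴ * X * U = diagonal (fun i => (x i : ℂ)) := by
    rw [conj_conj_eq h4, h1]; simp
  have hUZ : Uᴴ * Z * U = (Uᴴ * V) * diagonal (fun i => (z i : ℂ)) * (Uᴴ * V)ᴴ := by
    rw [conj_conj_eq hZ]
    simp only [conjTranspose_mul, conjTranspose_conjTranspose]
  set W := Uᴴ * V with hWdef
  have hpos : (W * diagonal (fun i => (z i : ℂ)) * Wᴴ - diagonal (fun i => (x i : ℂ))).PosSemidef := by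
    have := hXZ.conjTranspose_mul_mul_same U
    rwa [mul_sub, sub_mul, hUX, hUZ] at this
  have hzε : ∀ j, 0 < z j + ε := fun j => by linarith [hz j]
  have hq : ∀ i, x i * ∑ j, Complex.normSq (W i j) / (z j + ε) ≤ 1 := by
    intro i
    set q : ℝ := ∑ j, Complex.normSq (W i j) / (z j + ε) with hqdef
    let v : ι → ℂ := fun j => ((z j + ε : ℝ) : ℂ)⁻¹ * star (W i j)
    let u : ι → ℂ := W *ᵥ v
    have hWu : Wᴴ *ᵥ u = v := by
      simp only [u, mulVec_mulVec, hW1, one_mulVec]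
    have hui : u i = (q : ℂ) := by
      simp only [u, v, mulVec, dotProduct, hqdef, Complex.ofReal_sum]
      refine Finset.sum_congr rfl fun j _ => ?_
      rw [Complex.star_def, mul_left_comm, Complex.mul_conj]
      push_cast
      ring
    have hq0 : 0 ≤ q := Finset.sum_nonneg fun j _ =>
      div_nonneg (Complex.normSq_nonneg _) (hzε j).le
    have h5 := hpos.re_dotProduct_nonneg u
    rw [sub_mulVec, dotProduct_sub, map_sub] at h5
    have h6 : RCLike.re (star u ⬝ᵥ (W * diagonal (fun i => (z i : ℂ)) * Wᴴ) *ᵥ u) =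
        ∑ j, z j * Complex.normSq (v j) := by
      have hWv : star u ᵥ* W = star v := by
        rw [star_mulVec, vecMul_vecMul, hW1, vecMul_one]
      rw [← mulVec_mulVec, ← mulVec_mulVec, hWu, dotProduct_mulVec, hWv]
      simp only [dotProduct, mulVec_diagonal, map_sum]
      refine Finset.sum_congr rfl fun j _ => ?_
      simp [Complex.normSq_apply]
      ring
    have h7 : RCLike.re (star u ⬝ᵥ diagonal (fun i => (x i : ℂ)) *ᵥ u) =
        ∑ k, x k * Complex.normSq (u k) := by
      simp only [dotProduct, mulVec_diagonal, map_sum]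
      refine Finset.sum_congr rfl fun j _ => ?_
      simp [Complex.normSq_apply]
      ring
    have h8 : x i * q ^ 2 ≤ ∑ k, x k * Complex.normSq (u k) := by
      have := Finset.single_le_sum (f := fun k => x k * Complex.normSq (u k))
        (fun k _ => mul_nonneg (h3 k) (Complex.normSq_nonneg _)) (Finset.mem_univ i)
      simpa [hui, Complex.normSq_ofReal, sq] using this
    have h9 : ∑ j, z j * Complex.normSq (v j) ≤ q := by
      refine Finset.sum_le_sum fun j _ => ?_
      simp only [v, Complex.normSq_mul, Complex.normSq_inv, Complex.normSq_ofReal,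
        Complex.star_def, Complex.normSq_conj]
      have := hzε j
      have h0 := Complex.normSq_nonneg (W i j)
      rw [div_eq_inv_mul, ← mul_assoc]
      refine mul_le_mul_of_nonneg_right ?_ h0
      rw [mul_inv, ← mul_assoc]
      refine mul_le_of_le_one_left (inv_pos.2 this).le ?_
      rw [← div_eq_mul_inv, div_le_one this]
      linarith
    rw [h6, h7] at h5
    rcases hq0.eq_or_lt with h | h
    · rw [← h]; simp
    · have : x i * q * q ≤ 1 * q := by nlinarith
      exact le_of_mul_le_mul_right this h
  calc ∑ j, (∑ i, Complex.normSq (W i j) * x i) * (z j + ε) ^ (t - 1)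
      = ∑ i, x i * ∑ j, Complex.normSq (W i j) * (z j + ε) ^ (t - 1) := by
        simp only [Finset.sum_mul, Finset.mul_sum]
        rw [Finset.sum_comm]
        refine Finset.sum_congr rfl fun i _ => Finset.sum_congr rfl fun j _ => ?_
        ring
    _ ≤ ∑ i, x i ^ t := by
        refine Finset.sum_le_sum fun i _ => ?_
        rcases (h3 i).eq_or_lt with h | h
        · rw [← h, zero_mul, Real.zero_rpow ht0.ne']
        have hj := (Real.concaveOn_rpow (p := 1 - t) (by linarith) (by linarith)).le_map_sum
          (t := Finset.univ) (w := fun j => Complex.normSq (W i j)) (p := fun j => (z j + ε)⁻¹)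
          (fun j _ => Complex.normSq_nonneg _) (sum_normSq_row hW2 i)
          (fun j _ => (inv_pos.2 (hzε j)).le)
        simp only [smul_eq_mul] at hj
        have h5 : ∀ j, (z j + ε)⁻¹ ^ (1 - t) = (z j + ε) ^ (t - 1) := by
          intro j
          rw [Real.inv_rpow (hzε j).le, ← Real.rpow_neg (hzε j).le, neg_sub]
        simp only [h5, ← div_eq_mul_inv] at hj
        have h6 : (∑ j, Complex.normSq (W i j) / (z j + ε)) ^ (1 - t) ≤ (x i)⁻¹ ^ (1 - t) := by
          refine Real.rpow_le_rpow (Finset.sum_nonneg fun j _ =>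
            div_nonneg (Complex.normSq_nonneg _) (hzε j).le) ?_ (by linarith)
          rw [← one_div, le_div_iff₀ h, mul_comm]
          exact hq i
        calc _ ≤ x i * (x i)⁻¹ ^ (1 - t) :=
              mul_le_mul_of_nonneg_left (hj.trans h6) h.le
          _ = x i ^ t := by
              rw [Real.inv_rpow h.le, ← Real.rpow_neg h.le]
              nth_rewrite 1 [← Real.rpow_one (x i)]
              rw [← Real.rpow_add h]
              congr 1
              ring

lemma trace_pos_diag_re_le {X Z V : Matrix ι ι ℂ} (hV : Vᴴ * V = 1) {z : ι → ℝ}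
    (hZ : Z = V * diagonal (fun i => (z i : ℂ)) * Vᴴ) (hXZ : (Z - X).PosSemidef) (j : ι) :
    ((Vᴴ * X * V) j j).re ≤ z j := by
  have h1 := (hXZ.conjTranspose_mul_mul_same V).diag_nonneg (i := j)
  rw [mul_sub, sub_mul, conj_conj_eq hZ, hV] at h1
  have h2 := (Complex.le_def.1 h1).1
  simp at h2
  exact h2

lemma tracePow_mono {X Z : Matrix ι ι ℂ} (hX : X.PosSemidef) (hXZ : (Z - X).PosSemidef)
    {t : ℝ} (ht0 : 0 < t) (ht1 : t ≤ 1) : tracePow t X ≤ tracePow t Z := by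
  have hZp : Z.PosSemidef := by simpa using hXZ.add hX
  obtain ⟨V, z, h1, h2, h3, h4⟩ := hZp.exists_conj_diagonal
  rw [tracePow_conj_diagonal h1 h4]
  refine ge_of_tendsto (tendsto_sum_add_rpow z ht0) ?_
  filter_upwards [self_mem_nhdsWithin] with ε (hε : 0 < ε)
  have hzε : ∀ j, 0 < z j + ε := fun j => by linarith [h3 j]
  have hS : 0 ≤ ∑ j, (z j + ε) ^ t := Finset.sum_nonneg fun j _ => Real.rpow_nonneg (hzε j).le _
  refine (tracePow_le_holder hX h1 h2 hzε ht0 ht1).trans ?_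
  have h5 : ∑ j, ((Vᴴ * X * V) j j).re * (z j + ε) ^ (t - 1) ≤ ∑ j, (z j + ε) ^ t := by
    refine Finset.sum_le_sum fun j _ => ?_
    calc _ ≤ (z j + ε) * (z j + ε) ^ (t - 1) :=
          mul_le_mul_of_nonneg_right ((trace_pos_diag_re_le h1 h4 hXZ j).trans (by linarith))
            (Real.rpow_nonneg (hzε j).le _)
      _ = _ := by
          nth_rewrite 1 [← Real.rpow_one (z j + ε)]
          rw [← Real.rpow_add (hzε j)]
          congr 1
          ring
  have h6 : 0 ≤ ∑ j, ((Vᴴ * X * V) j j).re * (z j + ε) ^ (t - 1) :=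
    Finset.sum_nonneg fun j _ => mul_nonneg
      ((Complex.le_def.1 ((hX.conjTranspose_mul_mul_same V).diag_nonneg (i := j))).1)
      (Real.rpow_nonneg (hzε j).le _)
  calc _ ≤ (∑ j, (z j + ε) ^ t) ^ t * (∑ j, (z j + ε) ^ t) ^ (1 - t) :=
        mul_le_mul_of_nonneg_right (Real.rpow_le_rpow h6 h5 ht0.le) (Real.rpow_nonneg hS _)
    _ = _ := by rw [← Real.rpow_add' hS (by simp)]; simp

/-- Subadditivity of `X ↦ Tr X^t` for `0 < t ≤ 1`. -/
lemma tracePow_add_le {X Y : Matrix ι ι ℂ} (hX : X.PosSemidef) (hY : Y.PosSemidef)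
    {t : ℝ} (ht0 : 0 < t) (ht1 : t ≤ 1) :
    tracePow t (X + Y) ≤ tracePow t X + tracePow t Y := by
  obtain ⟨V, z, h1, h2, h3, h4⟩ := (hX.add hY).exists_conj_diagonal
  rw [tracePow_conj_diagonal h1 h4]
  have hlim : Filter.Tendsto (fun ε : ℝ => ∑ j, z j * (z j + ε) ^ (t - 1))
      (nhdsWithin 0 (Set.Ioi 0)) (nhds (∑ j, z j ^ t)) := by
    refine tendsto_finsetSum _ fun j _ => ?_
    rcases (h3 j).eq_or_lt with h | h
    · rw [← h, Real.zero_rpow ht0.ne']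
      simp
    · have hc : ContinuousAt (fun ε : ℝ => z j * (z j + ε) ^ (t - 1)) 0 := by
        refine continuousAt_const.mul ?_
        exact (continuousAt_const.add continuousAt_id).rpow_const (Or.inl (by simpa using h.ne'))
      have h5 : z j * (z j + 0) ^ (t - 1) = z j ^ t := by
        rw [add_zero]
        nth_rewrite 1 [← Real.rpow_one (z j)]
        rw [← Real.rpow_add h]
        congr 1
        ring
      rw [← h5]
      exact hc.tendsto.mono_left nhdsWithin_le_nhds
  refine le_of_tendsto hlim ?_
  filter_upwards [self_mem_nhdsWithin] with ε (hε : 0 < ε)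
  have hx := sum_diag_mul_rpow_le_tracePow hX h1 h2 h3 h4 (by simpa using hY) hε ht0 ht1
  have hy := sum_diag_mul_rpow_le_tracePow hY h1 h2 h3 h4 (by simpa using hX) hε ht0 ht1
  refine le_trans (le_of_eq ?_) (add_le_add hx hy)
  rw [← Finset.sum_add_distrib]
  refine Finset.sum_congr rfl fun j _ => ?_
  rw [← add_mul]
  congr 1
  have h5 : Vᴴ * (X + Y) * V = diagonal (fun i => (z i : ℂ)) := by
    rw [conj_conj_eq h4, h1]; simp
  have h6 := congrArg Complex.re (congrFun (congrFun h5 j) j)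
  rw [mul_add, add_mul] at h6
  simpa using h6.symm

end TraceInequalities

section SchattenPow

variable {ι : Type*} [Fintype ι] [DecidableEq ι]

/-- A version of `tracePow_le_holder` allowing zero weights. -/
lemma tracePow_le_holder_of_nonneg {X V : Matrix ι ι ℂ} (hX : X.PosSemidef) (hV : Vᴴ * V = 1)
    (hV' : V * Vᴴ = 1) {y : ι → ℝ} (hy : ∀ j, 0 ≤ y j)
    (hXy : ∀ j, y j = 0 → ((Vᴴ * X * V) j j).re = 0) {t : ℝ} (ht0 : 0 < t) (ht1 : t ≤ 1) :
    tracePow t X ≤ (∑ j, ((Vᴴ * X * V) j j).re * y j ^ (t - 1)) ^ t *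
      (∑ j, y j ^ t) ^ (1 - t) := by
  have hc : Continuous (fun ε : ℝ => (∑ j, ((Vᴴ * X * V) j j).re * y j ^ (t - 1)) ^ t *
      (∑ j, (if y j = 0 then ε else y j) ^ t) ^ (1 - t)) := by
    refine continuous_const.mul ((continuous_finsetSum _ fun j _ => ?_).rpow_const
      fun _ => Or.inr (by linarith))
    refine Continuous.rpow_const ?_ fun _ => Or.inr ht0.le
    split_ifs
    · exact continuous_id
    · exact continuous_const
  have hlim := (hc.tendsto 0).mono_left (nhdsWithin_le_nhds (s := Set.Ioi 0))
  have h0 : ∀ j, (if y j = 0 then 0 else y j) = y j := by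
    intro j
    split_ifs with h
    · exact h.symm
    · rfl
  simp only [h0] at hlim
  refine ge_of_tendsto hlim ?_
  filter_upwards [self_mem_nhdsWithin] with ε (hε : 0 < ε)
  have hyε : ∀ j, 0 < (if y j = 0 then ε else y j) := by
    intro j
    split_ifs with h
    · exact hε
    · exact (hy j).lt_of_ne' h
  refine (tracePow_le_holder hX hV hV' hyε ht0 ht1).trans (le_of_eq ?_)
  congr 2
  refine Finset.sum_congr rfl fun j _ => ?_
  by_cases h : y j = 0
  · rw [hXy j h, zero_mul, zero_mul]
  · rw [if_neg h]

/-- The `p`-th power of the Schatten `p`-norm. -/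
noncomputable def schattenPow (p : ℝ) (A : Matrix ι ι ℂ) : ℝ := tracePow (p / 2) (Aᴴ * A)

lemma schattenPow_nonneg (p : ℝ) (A : Matrix ι ι ℂ) : 0 ≤ schattenPow p A :=
  tracePow_nonneg _ (posSemidef_conjTranspose_mul_self A)

lemma schattenNorm_eq (p : ℝ) (A : Matrix ι ι ℂ) :
    schattenNorm p A = schattenPow p A ^ (1 / p) := by
  rw [schattenNorm, trace_posPow (isHermitian_conjTranspose_mul_self A), schattenPow]

lemma schattenNorm_rpow {p : ℝ} (hp : 0 < p) (A : Matrix ι ι ℂ) :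
    schattenNorm p A ^ p = schattenPow p A := by
  rw [schattenNorm_eq, ← Real.rpow_mul (schattenPow_nonneg p A), one_div_mul_cancel hp.ne',
    Real.rpow_one]

lemma schattenNorm_sq (p : ℝ) (A : Matrix ι ι ℂ) :
    schattenNorm p A ^ 2 = schattenPow p A ^ (2 / p) := by
  rw [schattenNorm_eq, ← Real.rpow_natCast, ← Real.rpow_mul (schattenPow_nonneg p A)]
  congr 1
  push_cast
  ring

lemma schattenPow_conjTranspose (p : ℝ) (A : Matrix ι ι ℂ) :
    schattenPow p Aᴴ = schattenPow p A := by
  rw [schattenPow, conjTranspose_conjTranspose, tracePow_mul_comm, schattenPow]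

lemma schattenPow_neg (p : ℝ) (A : Matrix ι ι ℂ) : schattenPow p (-A) = schattenPow p A := by
  simp [schattenPow]

lemma schattenPow_unitary_mul (p : ℝ) {U : Matrix ι ι ℂ} (hU : Uᴴ * U = 1) (A : Matrix ι ι ℂ) :
    schattenPow p (U * A) = schattenPow p A := by
  rw [schattenPow, schattenPow, conjTranspose_mul]
  congr 1
  calc Aᴴ * Uᴴ * (U * A) = Aᴴ * (Uᴴ * U) * A := by simp only [mul_assoc]
    _ = _ := by rw [hU, mul_one]

lemma schattenPow_mul_unitary (p : ℝ) {U : Matrix ι ι ℂ} (hU : U * Uᴴ = 1) (A : Matrix ι ι ℂ) :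
    schattenPow p (A * U) = schattenPow p A := by
  rw [← schattenPow_conjTranspose, conjTranspose_mul, schattenPow_unitary_mul,
    schattenPow_conjTranspose]
  rwa [conjTranspose_conjTranspose]

lemma schattenPow_reindex {κ : Type*} [Fintype κ] [DecidableEq κ] (e : ι ≃ κ) (p : ℝ)
    (A : Matrix ι ι ℂ) : schattenPow p (reindex e e A) = schattenPow p A := by
  rw [schattenPow, schattenPow, ← tracePow_reindex e]
  simp [reindex_apply, submatrix_mul_equiv]

lemma schattenPow_diagonal (p : ℝ) (d : ι → ℂ) :
    schattenPow p (diagonal d) = ∑ i, ‖d i‖ ^ p := by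
  rw [schattenPow, tracePow_conj_diagonal (U := 1) (V := 1) (d := fun i => ‖d i‖ ^ 2) (by simp)]
  · refine Finset.sum_congr rfl fun i _ => ?_
    rw [← Real.rpow_natCast, ← Real.rpow_mul (norm_nonneg _)]
    congr 1
    push_cast
    ring
  · rw [diagonal_conjTranspose, diagonal_mul_diagonal, one_mul, mul_one]
    congr 1
    ext i
    simp [Complex.conj_mul']

lemma schattenPow_blockDiagonal {κ : Type*} [Fintype κ] [DecidableEq κ] (p : ℝ)
    (A : κ → Matrix ι ι ℂ) : schattenPow p (blockDiagonal A) = ∑ k, schattenPow p (A k) := by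
  choose U d h1 h2 h3 h4 using fun k => (posSemidef_conjTranspose_mul_self (A k)).exists_conj_diagonal
  simp only [schattenPow, fun k => tracePow_conj_diagonal (h1 k) (h4 k)]
  rw [tracePow_conj_diagonal (U := blockDiagonal U) (V := blockDiagonal fun k => (U k)ᴴ)
    (d := fun q => d q.2 q.1)]
  · rw [Fintype.sum_prod_type_right]
  · rw [← blockDiagonal_mul, ← blockDiagonal_one]
    congr 1
    ext1 k
    exact h1 k
  · rw [← blockDiagonal_diagonal (fun k i => (d k i : ℂ)), ← blockDiagonal_mul,
      ← blockDiagonal_mul, blockDiagonal_conjTranspose, ← blockDiagonal_mul]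
    congr 1
    ext1 k
    exact h4 k

lemma schattenPow_fromBlocks_zero (p : ℝ) (A B : Matrix ι ι ℂ) :
    schattenPow p (fromBlocks 0 A B 0) = schattenPow p A + schattenPow p B := by
  obtain ⟨U, d, h1, h2, h3, h4⟩ := (posSemidef_conjTranspose_mul_self A).exists_conj_diagonal
  obtain ⟨V, e, k1, k2, k3, k4⟩ := (posSemidef_conjTranspose_mul_self B).exists_conj_diagonal
  simp only [schattenPow, tracePow_conj_diagonal h1 h4, tracePow_conj_diagonal k1 k4]
  rw [tracePow_conj_diagonal (U := fromBlocks V 0 0 U) (V := fromBlocks Vᴴ 0 0 Uᴴ)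
    (d := Sum.elim e d)]
  · simp [add_comm]
  · simp [fromBlocks_multiply, h1, k1]
  · have : (diagonal fun i => ((Sum.elim e d i : ℝ) : ℂ)) =
        fromBlocks (diagonal fun i => (e i : ℂ)) 0 0 (diagonal fun i => (d i : ℂ)) := by
      rw [fromBlocks_diagonal]
      congr 1
      ext i
      cases i <;> rfl
    rw [this]
    simp only [fromBlocks_conjTranspose, fromBlocks_multiply, conjTranspose_zero, zero_mul,
      mul_zero, zero_add, add_zero, k4, h4]

lemma schattenPow_two (A : Matrix ι ι ℂ) : schattenPow 2 A = ∑ i, ∑ j, Complex.normSq (A i j) := by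
  rw [schattenPow, div_self two_ne_zero, tracePow_one (isHermitian_conjTranspose_mul_self A),
    trace, Complex.re_sum, Finset.sum_comm]
  refine Finset.sum_congr rfl fun j _ => ?_
  rw [diag_apply, mul_apply, Complex.re_sum]
  refine Finset.sum_congr rfl fun i _ => ?_
  simp [Complex.normSq_apply]

lemma schattenPow_zero {p : ℝ} (hp : 0 < p) : schattenPow p (0 : Matrix ι ι ℂ) = 0 := by
  rw [← diagonal_zero, schattenPow_diagonal]
  simp [Real.zero_rpow hp.ne']

lemma schattenPow_add_le_of_pos {p : ℝ} (hp0 : 0 < p) (hp2 : p ≤ 2) (X Y : Matrix ι ι ℂ) {η : ℝ}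
    (hη : 0 < η) :
    schattenPow p (X + Y) ≤ (1 + η) * schattenPow p X + (1 + η⁻¹) * schattenPow p Y := by
  have ht0 : 0 < p / 2 := by linarith
  have ht1 : p / 2 ≤ 1 := by linarith
  have hη' : 0 < η⁻¹ := inv_pos.2 hη
  have hXp := posSemidef_conjTranspose_mul_self X
  have hYp := posSemidef_conjTranspose_mul_self Y
  have hs : ∀ c : ℝ, 0 ≤ c → ∀ Z : Matrix ι ι ℂ, Z.PosSemidef → ((c : ℂ) • Z).PosSemidef := by
    intro c hc Z hZ
    exact hZ.smul (by exact_mod_cast hc)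
  have h1 : (((1 + η : ℝ) : ℂ) • (Xᴴ * X) + ((1 + η⁻¹ : ℝ) : ℂ) • (Yᴴ * Y) -
      (X + Y)ᴴ * (X + Y)).PosSemidef := by
    have h := hs η⁻¹ hη'.le _ (posSemidef_conjTranspose_mul_self ((η : ℂ) • X - Y))
    convert h using 1
    have hne : (η : ℂ) ≠ 0 := by exact_mod_cast hη.ne'
    simp only [conjTranspose_add, conjTranspose_sub, conjTranspose_smul, add_mul, mul_add,
      sub_mul, mul_sub, smul_mul_assoc, mul_smul_comm, smul_sub, smul_smul, Complex.star_def,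
      Complex.conj_ofReal]
    push_cast
    rw [← mul_assoc, inv_mul_cancel₀ hne]
    module
  have h2 : ∀ c : ℝ, 1 ≤ c → ∀ Z : Matrix ι ι ℂ, Z.PosSemidef →
      tracePow (p / 2) ((c : ℂ) • Z) ≤ c * tracePow (p / 2) Z := by
    intro c hc Z hZ
    rw [tracePow_smul hZ (by linarith)]
    refine mul_le_mul_of_nonneg_right ?_ (tracePow_nonneg _ hZ)
    calc c ^ (p / 2) ≤ c ^ (1 : ℝ) := Real.rpow_le_rpow_of_exponent_le hc ht1
      _ = c := Real.rpow_one c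
  calc schattenPow p (X + Y)
      ≤ tracePow (p / 2) (((1 + η : ℝ) : ℂ) • (Xᴴ * X) + ((1 + η⁻¹ : ℝ) : ℂ) • (Yᴴ * Y)) :=
        tracePow_mono (posSemidef_conjTranspose_mul_self _) h1 ht0 ht1
    _ ≤ tracePow (p / 2) (((1 + η : ℝ) : ℂ) • (Xᴴ * X)) +
        tracePow (p / 2) (((1 + η⁻¹ : ℝ) : ℂ) • (Yᴴ * Y)) :=
        tracePow_add_le (hs _ (by linarith) _ hXp) (hs _ (by linarith) _ hYp) ht0 ht1
    _ ≤ _ := add_le_add (h2 _ (by linarith) _ hXp) (h2 _ (by linarith) _ hYp)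

/-- `A ↦ ‖A‖_p^(p/2)` satisfies the triangle inequality for `0 < p ≤ 2`. -/
lemma sqrt_schattenPow_add_le {p : ℝ} (hp0 : 0 < p) (hp2 : p ≤ 2) (X Y : Matrix ι ι ℂ) :
    √(schattenPow p (X + Y)) ≤ √(schattenPow p X) + √(schattenPow p Y) := by
  set a := √(schattenPow p X)
  set b := √(schattenPow p Y)
  have ha : a ^ 2 = schattenPow p X := Real.sq_sqrt (schattenPow_nonneg _ _)
  have hb : b ^ 2 = schattenPow p Y := Real.sq_sqrt (schattenPow_nonneg _ _)
  have ha0 : 0 ≤ a := Real.sqrt_nonneg _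
  have hb0 : 0 ≤ b := Real.sqrt_nonneg _
  refine le_of_forall_pos_le_add fun δ hδ => ?_
  set a' := a + δ / 2 with ha'
  set b' := b + δ / 2 with hb'
  have ha'0 : 0 < a' := by positivity
  have hb'0 : 0 < b' := by positivity
  refine Real.sqrt_le_iff.2 ⟨by positivity, ?_⟩
  have h1 : 0 < b' / a' := by positivity
  refine (schattenPow_add_le_of_pos hp0 hp2 X Y h1).trans ?_
  rw [← ha, ← hb]
  have h2 : a ^ 2 ≤ a' ^ 2 := pow_le_pow_left₀ ha0 (by linarith) 2
  have h3 : b ^ 2 ≤ b' ^ 2 := pow_le_pow_left₀ hb0 (by linarith) 2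
  calc (1 + b' / a') * a ^ 2 + (1 + (b' / a')⁻¹) * b ^ 2
      ≤ (1 + b' / a') * a' ^ 2 + (1 + (b' / a')⁻¹) * b' ^ 2 := by gcongr
    _ = (a' + b') ^ 2 := by field_simp; ring
    _ = _ := by rw [ha', hb']; ring

lemma abs_sqrt_schattenPow_sub_le {p : ℝ} (hp0 : 0 < p) (hp2 : p ≤ 2) (X Y : Matrix ι ι ℂ) :
    |√(schattenPow p X) - √(schattenPow p Y)| ≤ √(schattenPow p (X - Y)) := by
  rw [abs_sub_le_iff]
  constructor
  · have := sqrt_schattenPow_add_le hp0 hp2 (X - Y) Y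
    rw [sub_add_cancel] at this
    linarith
  · have := sqrt_schattenPow_add_le hp0 hp2 (Y - X) X
    rw [sub_add_cancel, ← neg_sub X Y, schattenPow_neg] at this
    linarith

lemma schattenPow_add_le {p : ℝ} (hp0 : 0 < p) (hp2 : p ≤ 2) (X Y : Matrix ι ι ℂ) :
    schattenPow p (X + Y) ≤ 2 * (schattenPow p X + schattenPow p Y) := by
  have := schattenPow_add_le_of_pos hp0 hp2 X Y one_pos
  rw [inv_one] at this
  linarith

/-- A bound for the Schatten norm of a matrix whose columns vanish outside of `J`. -/
lemma schattenPow_le_card {p : ℝ} (hp0 : 0 < p) (hp2 : p ≤ 2) (A : Matrix ι ι ℂ) (J : Finset ι)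
    (hJ : ∀ j, j ∉ J → ∀ i, A i j = 0) :
    schattenPow p A ≤ schattenPow 2 A ^ (p / 2) * (J.card : ℝ) ^ (1 - p / 2) := by
  have ht0 : 0 < p / 2 := by linarith
  have h := tracePow_le_holder_of_nonneg (posSemidef_conjTranspose_mul_self A) (V := 1) (by simp)
    (by simp) (y := fun j => if j ∈ J then 1 else 0) (fun j => by split_ifs <;> simp) ?_
    ht0 (by linarith)
  · refine h.trans (le_of_eq ?_)
    have e1 : ∑ j, (if j ∈ J then (1 : ℝ) else 0) ^ (p / 2) = J.card := by
      rw [Finset.sum_congr rfl (g := fun j => if j ∈ J then (1 : ℝ) else 0)]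
      · simp
      · intro j _
        split_ifs <;> simp [ht0.ne']
    rw [e1]
    congr 2
    rw [schattenPow_two, Finset.sum_comm]
    refine Finset.sum_congr rfl fun j _ => ?_
    simp only [conjTranspose_one, one_mul, mul_one]
    by_cases hj : j ∈ J
    · rw [if_pos hj, Real.one_rpow, mul_one, mul_apply, Complex.re_sum]
      refine Finset.sum_congr rfl fun i _ => ?_
      simp [Complex.normSq_apply]
    · rw [mul_apply, Finset.sum_eq_zero fun i _ => by rw [hJ j hj i, mul_zero],
        Finset.sum_eq_zero fun i _ => by rw [hJ j hj i, map_zero]]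
      simp
  · intro j hj
    have hj' : j ∉ J := by
      by_contra h'
      simp [h'] at hj
    simp only [conjTranspose_one, one_mul, mul_one]
    rw [mul_apply, Finset.sum_eq_zero fun i _ => by rw [hJ j hj' i, mul_zero]]
    simp

lemma continuous_schattenPow {p : ℝ} (hp0 : 0 < p) (hp2 : p ≤ 2) :
    Continuous (schattenPow p : Matrix ι ι ℂ → ℝ) := by
  have h2 : Continuous (fun A : Matrix ι ι ℂ => schattenPow 2 A) := by
    simp only [schattenPow_two]
    refine continuous_finsetSum _ fun i _ => continuous_finsetSum _ fun j _ => ?_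
    exact Complex.continuous_normSq.comp (continuous_id.matrix_elem i j)
  have hs : Continuous (fun A : Matrix ι ι ℂ => √(schattenPow p A)) := by
    rw [continuous_iff_continuousAt]
    intro A
    rw [ContinuousAt, tendsto_iff_dist_tendsto_zero]
    have hb : Continuous (fun B : Matrix ι ι ℂ => √(schattenPow 2 (B - A) ^ (p / 2) *
        ((Finset.univ : Finset ι).card : ℝ) ^ (1 - p / 2))) := by
      refine Real.continuous_sqrt.comp (Continuous.mul ?_ continuous_const)
      exact (h2.comp (continuous_id.sub continuous_const)).rpow_const
        fun _ => Or.inr (by linarith)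
    have hb0 := hb.tendsto A
    rw [sub_self, schattenPow_zero two_pos, Real.zero_rpow (by linarith), zero_mul,
      Real.sqrt_zero] at hb0
    refine squeeze_zero (fun _ => dist_nonneg) (fun B => ?_) hb0
    refine (abs_sqrt_schattenPow_sub_le hp0 hp2 B A).trans (Real.sqrt_le_sqrt ?_)
    exact schattenPow_le_card hp0 hp2 _ Finset.univ fun j hj => absurd (Finset.mem_univ j) hj
  have e : (schattenPow p : Matrix ι ι ℂ → ℝ) = fun A => √(schattenPow p A) ^ 2 :=
    funext fun A => (Real.sq_sqrt (schattenPow_nonneg _ _)).symm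
  rw [e]
  exact hs.pow 2

/-- Hölder's inequality `‖AB‖_p ≤ ‖A‖_2 ‖B‖_r` for `1/p = 1/2 + 1/r`. -/
lemma schattenPow_mul_le {p : ℝ} (hp0 : 0 < p) (hp2 : p < 2) (A B : Matrix ι ι ℂ) :
    schattenPow p (A * B) ≤
      schattenPow 2 A ^ (p / 2) * schattenPow (2 * p / (2 - p)) B ^ (1 - p / 2) := by
  have ht0 : 0 < p / 2 := by linarith
  have ht1 : 0 < 1 - p / 2 := by linarith
  have h2p : 0 < 2 - p := by linarith
  obtain ⟨V, β, h1, h2, h3, h4⟩ := (posSemidef_conjTranspose_mul_self B).exists_conj_diagonal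
  set C := B * V with hC
  have hCC : Cᴴ * C = diagonal (fun i => (β i : ℂ)) := by
    have := conj_conj_eq (V := V) h4
    rw [h1] at this
    rw [hC, conjTranspose_mul]
    simpa [mul_assoc] using this
  have hdiag : ∀ j, ((Vᴴ * ((A * B)ᴴ * (A * B)) * V) j j).re =
      (((A * C)ᴴ * (A * C)) j j).re := by
    intro j
    congr 2
    simp only [hC, conjTranspose_mul, mul_assoc]
  have hcol : ∀ j, β j = 0 → ∀ i, C i j = 0 := by
    intro j hj i
    have h5 := congrArg Complex.re (congrFun (congrFun hCC j) j)
    rw [diagonal_apply_eq, hj, mul_apply, Complex.re_sum] at h5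
    have h6 : ∑ i, Complex.normSq (C i j) = 0 := by
      rw [← Complex.ofReal_re 0, ← h5]
      refine Finset.sum_congr rfl fun i _ => ?_
      simp [Complex.normSq_apply]
    rw [Finset.sum_eq_zero_iff_of_nonneg fun _ _ => Complex.normSq_nonneg _] at h6
    exact Complex.normSq_eq_zero.1 (h6 i (Finset.mem_univ i))
  have hcol' : ∀ j, β j = 0 → (((A * C)ᴴ * (A * C)) j j) = 0 := by
    intro j hj
    rw [mul_apply]
    refine Finset.sum_eq_zero fun i _ => ?_
    have : (A * C) i j = 0 := by
      rw [mul_apply]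
      exact Finset.sum_eq_zero fun k _ => by rw [hcol j hj k, mul_zero]
    rw [this, mul_zero]
  have key := tracePow_le_holder_of_nonneg (posSemidef_conjTranspose_mul_self (A * B)) h1 h2
    (y := fun j => β j ^ (1 - p / 2)⁻¹) (fun j => Real.rpow_nonneg (h3 j) _) ?_ ht0
    (by linarith)
  · have e1 : ∀ j, (β j ^ (1 - p / 2)⁻¹) ^ (p / 2 - 1) = (β j)⁻¹ := by
      intro j
      rw [← Real.rpow_mul (h3 j), ← neg_sub 1 (p / 2), mul_neg, inv_mul_cancel₀ ht1.ne',
        Real.rpow_neg_one]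
    have e2 : ∑ j, (β j ^ (1 - p / 2)⁻¹) ^ (p / 2) = schattenPow (2 * p / (2 - p)) B := by
      rw [schattenPow, tracePow_conj_diagonal h1 h4]
      refine Finset.sum_congr rfl fun j _ => ?_
      rw [← Real.rpow_mul (h3 j)]
      congr 1
      field_simp
    simp only [e1, hdiag] at key
    rw [e2] at key
    refine key.trans (mul_le_mul_of_nonneg_right ?_
      (Real.rpow_nonneg (schattenPow_nonneg _ _) _))
    refine Real.rpow_le_rpow (Finset.sum_nonneg fun j _ => mul_nonneg
      ((Complex.le_def.1 ((posSemidef_conjTranspose_mul_self (A * C)).diag_nonneg (i := j))).1)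
      (inv_nonneg.2 (h3 j))) ?_ ht0.le
    set E : Matrix ι ι ℂ := diagonal (fun j => ((β j)⁻¹ : ℂ)) with hE
    set G := C * E * Cᴴ with hG
    have hEE : E * diagonal (fun i => (β i : ℂ)) * E = E := by
      rw [hE, diagonal_mul_diagonal, diagonal_mul_diagonal]
      congr 1
      ext j
      by_cases h : (β j : ℂ) = 0
      · simp [h]
      · field_simp
    have hEH : Eᴴ = E := by
      rw [hE, diagonal_conjTranspose]
      congr 1
      ext j
      simp
    have hGG : G * G = G := by
      calc G * G = C * (E * (Cᴴ * C) * E) * Cᴴ := by simp only [hG, mul_assoc]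
        _ = G := by rw [hCC, hEE]
    have hGH : Gᴴ = G := by
      rw [hG, conjTranspose_mul (C * E), conjTranspose_mul C E, conjTranspose_conjTranspose, hEH]
      exact (mul_assoc C E Cᴴ).symm
    have h1G : (1 - G).PosSemidef := by
      have := posSemidef_conjTranspose_mul_self (1 - G)
      have e : (1 - G)ᴴ * (1 - G) = 1 - G := by
        rw [conjTranspose_sub, conjTranspose_one, hGH, sub_mul, one_mul, mul_sub, mul_one, hGG,
          sub_self, sub_zero]
      rwa [e] at this
    have htr : 0 ≤ (A * (1 - G) * Aᴴ).trace.re :=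
      (Complex.le_def.1 (h1G.mul_mul_conjTranspose_same A).trace_nonneg).1
    have e3 : (A * G * Aᴴ).trace.re = ∑ j, (((A * C)ᴴ * (A * C)) j j).re * (β j)⁻¹ := by
      have : A * G * Aᴴ = (A * C * E) * (A * C)ᴴ := by
        simp only [hG, conjTranspose_mul, mul_assoc]
      rw [this, trace_mul_comm, ← mul_assoc, trace, Complex.re_sum]
      refine Finset.sum_congr rfl fun j _ => ?_
      rw [diag_apply, hE, mul_diagonal, ← Complex.ofReal_inv, Complex.re_mul_ofReal]
    have e4 : (A * Aᴴ).trace.re = schattenPow 2 A := by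
      rw [schattenPow, div_self two_ne_zero, tracePow_mul_comm,
        tracePow_one (isHermitian_mul_conjTranspose_self A)]
    rw [mul_sub, sub_mul, mul_one, trace_sub, Complex.sub_re, e3, e4] at htr
    linarith
  · intro j hj
    have hj0 : β j = 0 := by
      rwa [Real.rpow_eq_zero (h3 j) (inv_ne_zero ht1.ne')] at hj
    rw [hdiag, hcol' j hj0, Complex.zero_re]

end SchattenPow

section PinchingConvexity

/-- A quantitative form of the convexity of `t ↦ |t|^p` on `[-M, M]`. -/
lemma abs_rpow_sub_ge {p : ℝ} (hp1 : 1 < p) (hp2 : p ≤ 2) {M a b : ℝ} (ha : |a| ≤ M)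
    (hb : |b| ≤ M) :
    |a| ^ p + p * |a| ^ (p - 2) * a * (b - a) + p * (p - 1) / 2 * ((b - a) ^ 2 * M ^ (p - 2)) ≤
      |b| ^ p := by
  set m := M ^ (p - 2) with hm
  set g : ℝ → ℝ := fun t => p * |t| ^ (p - 2) * t - p * (p - 1) * m * t with hg
  have hM : 0 ≤ M := (abs_nonneg a).trans ha
  have hgodd : ∀ t, g (-t) = -g t := fun t => by simp only [hg, abs_neg]; ring
  have hg0 : g 0 = 0 := by simp [hg]
  have hder : ∀ t : ℝ, HasDerivAt (fun t => |t| ^ p - p * (p - 1) / 2 * m * t ^ 2) (g t) t := by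
    intro t
    have h1 := (hasDerivAt_abs_rpow t hp1).sub
      (((hasDerivAt_id t).pow 2).const_mul (p * (p - 1) / 2 * m))
    refine h1.congr_deriv ?_
    simp [hg]
    ring
  have hgpos : ∀ t, 0 ≤ t → g t = p * t ^ (p - 1) - p * (p - 1) * m * t := by
    intro t ht
    rcases ht.eq_or_lt with rfl | ht
    · rw [hg0, Real.zero_rpow (by linarith)]
      ring
    · simp only [hg]
      rw [abs_of_pos ht, show p - 1 = (p - 2) + 1 by ring, Real.rpow_add_one ht.ne']
      ring
  have hmono0 : MonotoneOn g (Set.Icc 0 M) := by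
    have : MonotoneOn (fun t : ℝ => p * t ^ (p - 1) - p * (p - 1) * m * t) (Set.Icc 0 M) := by
      refine monotoneOn_of_hasDerivWithinAt_nonneg
        (f' := fun t => p * (p - 1) * (t ^ (p - 2) - m)) (convex_Icc 0 M) ?_ ?_ ?_
      · exact ((Continuous.continuousOn (continuous_const.mul (Real.continuous_rpow_const
          (by linarith)))).sub (Continuous.continuousOn (by fun_prop)))
      · intro t ht
        rw [interior_Icc] at ht
        have h1 := ((Real.hasDerivAt_rpow_const (x := t) (p := p - 1)
          (Or.inl ht.1.ne')).const_mul p).sub ((hasDerivAt_id t).const_mul (p * (p - 1) * m))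
        refine (h1.congr_deriv ?_).hasDerivWithinAt
        rw [show p - 1 - 1 = p - 2 by ring]
        ring
      · intro t ht
        rw [interior_Icc] at ht
        have : m ≤ t ^ (p - 2) := by
          rw [hm]
          exact Real.rpow_le_rpow_of_nonpos ht.1 ht.2.le (by linarith)
        have h1 : 0 ≤ p * (p - 1) := mul_nonneg (by linarith) (by linarith)
        exact mul_nonneg h1 (by linarith)
    exact this.congr fun t ht => (hgpos t ht.1).symm
  have hmono : ∀ s t : ℝ, |s| ≤ M → |t| ≤ M → s ≤ t → g s ≤ g t := by
    have h0 : ∀ t, 0 ≤ t → t ≤ M → 0 ≤ g t := fun t h1 h2 => by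
      rw [← hg0]
      exact hmono0 ⟨le_rfl, hM⟩ ⟨h1, h2⟩ h1
    intro s t hs ht hst
    rw [abs_le] at hs ht
    rcases le_total 0 s with h | h
    · exact hmono0 ⟨h, hs.2⟩ ⟨h.trans hst, ht.2⟩ hst
    · have h1 := hgodd s
      rcases le_total 0 t with h' | h'
      · have := h0 t h' ht.2
        have := h0 (-s) (by linarith) (by linarith)
        linarith
      · have h2 := hgodd t
        have := hmono0 (a := -t) (b := -s) ⟨by linarith, by linarith⟩ ⟨by linarith, by linarith⟩
          (by linarith)
        linarith
  set f : ℝ → ℝ := fun t => |t| ^ p - p * (p - 1) / 2 * m * t ^ 2 with hf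
  have hfc : Continuous f := continuous_iff_continuousAt.2 fun t => (hder t).continuousAt
  have key : g a * (b - a) ≤ f b - f a := by
    rcases lt_trichotomy a b with h | h | h
    · obtain ⟨c, hc, hc'⟩ := exists_hasDerivAt_eq_slope f g h hfc.continuousOn fun t _ => hder t
      have h1 : g a ≤ g c := hmono a c ha
        (abs_le.2 ⟨by linarith [(abs_le.1 ha).1, hc.1], by linarith [(abs_le.1 hb).2, hc.2]⟩) hc.1.le
      rwa [hc', le_div_iff₀ (by linarith)] at h1
    · simp [h]
    · obtain ⟨c, hc, hc'⟩ := exists_hasDerivAt_eq_slope f g h hfc.continuousOn fun t _ => hder t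
      have h1 : g c ≤ g a := hmono c a
        (abs_le.2 ⟨by linarith [(abs_le.1 hb).1, hc.1], by linarith [(abs_le.1 ha).2, hc.2]⟩) ha
        hc.2.le
      rw [hc', div_le_iff₀ (by linarith)] at h1
      linarith
  simp only [hf, hg] at key
  linarith [key, show p * (p - 1) / 2 * ((b - a) ^ 2 * m) = p * (p - 1) / 2 * m * b ^ 2 -
    p * (p - 1) / 2 * m * a ^ 2 - p * (p - 1) * m * a * (b - a) by ring]

variable {ι : Type*} [Fintype ι] [DecidableEq ι]

lemma schattenPow_le_weighted {p : ℝ} (hp0 : 0 < p) (hp2 : p < 2) (Z : Matrix ι ι ℂ) {y : ι → ℝ}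
    (hy : ∀ j, 0 ≤ y j) (hZ : ∀ j, y j = 0 → ∀ i, Z i j = 0) :
    schattenPow p Z ≤ (∑ i, ∑ j, Complex.normSq (Z i j) * y j ^ (p - 2)) ^ (p / 2) *
      (∑ j, y j ^ p) ^ (1 - p / 2) := by
  have h2p : 0 < 2 - p := by linarith
  set Y : Matrix ι ι ℂ := diagonal fun j => ((y j ^ ((2 - p) / 2) : ℝ) : ℂ) with hY
  set X : Matrix ι ι ℂ := of fun i j => Z i j * ((y j ^ ((p - 2) / 2) : ℝ) : ℂ) with hX
  have hXY : X * Y = Z := by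
    ext i j
    rw [hY, mul_diagonal, hX, of_apply, mul_assoc, ← Complex.ofReal_mul]
    rcases (hy j).eq_or_lt with h | h
    · rw [hZ j h.symm, zero_mul]
    · rw [← Real.rpow_add h, show (p - 2) / 2 + (2 - p) / 2 = 0 by ring, Real.rpow_zero]
      simp
  have h := schattenPow_mul_le hp0 hp2 X Y
  rw [hXY, schattenPow_two, hY, schattenPow_diagonal] at h
  convert h using 3
  · refine Finset.sum_congr rfl fun i _ => Finset.sum_congr rfl fun j _ => ?_
    rw [hX, of_apply, Complex.normSq_mul, Complex.normSq_ofReal]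
    rcases (hy j).eq_or_lt with h | h
    · rw [hZ j h.symm]
      simp
    · rw [← Real.rpow_add h, add_halves]
  · refine Finset.sum_congr rfl fun j _ => ?_
    rw [Complex.norm_real, Real.norm_of_nonneg (Real.rpow_nonneg (hy j) _), ← Real.rpow_mul (hy j)]
    congr 1
    field_simp

lemma schattenPow_conj_diagonal (p : ℝ) {U A : Matrix ι ι ℂ} {a : ι → ℝ} (hU : Uᴴ * U = 1)
    (hA : A = U * diagonal (fun i => (a i : ℂ)) * Uᴴ) : schattenPow p A = ∑ i, |a i| ^ p := by
  rw [hA, schattenPow_mul_unitary _ (by rwa [conjTranspose_conjTranspose]),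
    schattenPow_unitary_mul _ hU, schattenPow_diagonal]
  simp

/-- A quantitative Klein inequality. -/
lemma schattenPow_add_le_of_trace_eq_zero {p : ℝ} (hp1 : 1 < p) (hp2 : p ≤ 2)
    {A B U V : Matrix ι ι ℂ} {a b : ι → ℝ} (hU : Uᴴ * U = 1) (hU' : U * Uᴴ = 1)
    (hV : Vᴴ * V = 1) (hV' : V * Vᴴ = 1) (hA : A = U * diagonal (fun i => (a i : ℂ)) * Uᴴ)
    (hB : B = V * diagonal (fun i => (b i : ℂ)) * Vᴴ)
    (htr : (U * diagonal (fun i => ((p * |a i| ^ (p - 2) * a i : ℝ) : ℂ)) * Uᴴ * (B - A)).trace = 0) :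
    schattenPow p A + p * (p - 1) / 2 * ∑ j, ∑ i,
      Complex.normSq ((Vᴴ * (B - A) * U) j i) * max |a i| |b j| ^ (p - 2) ≤ schattenPow p B := by
  have hW1 := unitary_conj_mul hV' hU
  have hW2 := unitary_conj_mul' hV hU'
  have hUB := conj_conj_eq (V := U) hB
  have hUA : Uᴴ * A * U = diagonal (fun i => (a i : ℂ)) := by
    rw [conj_conj_eq hA, hU]
    simp
  have hζ : ∀ j i, (Vᴴ * (B - A) * U) j i = (Vᴴ * U) j i * ((b j - a i : ℝ) : ℂ) := by
    intro j i
    have e1 : Vᴴ * (B - A) * U = diagonal (fun i => (b i : ℂ)) * (Vᴴ * U) -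
        (Vᴴ * U) * diagonal (fun i => (a i : ℂ)) := by
      rw [mul_sub, sub_mul]
      congr 1
      · rw [hB]
        calc Vᴴ * (V * diagonal (fun i => (b i : ℂ)) * Vᴴ) * U =
            (Vᴴ * V) * diagonal (fun i => (b i : ℂ)) * (Vᴴ * U) := by simp only [mul_assoc]
          _ = _ := by rw [hV, one_mul]
      · rw [hA]
        calc Vᴴ * (U * diagonal (fun i => (a i : ℂ)) * Uᴴ) * U =
            Vᴴ * U * diagonal (fun i => (a i : ℂ)) * (Uᴴ * U) := by simp only [mul_assoc]
          _ = _ := by rw [hU, mul_one]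
    rw [e1, Matrix.sub_apply, diagonal_mul, mul_diagonal]
    push_cast
    ring
  have htr' : ∑ j, ∑ i, Complex.normSq ((Vᴴ * U) j i) *
      (p * |a i| ^ (p - 2) * a i * (b j - a i)) = 0 := by
    have e1 : (U * diagonal (fun i => ((p * |a i| ^ (p - 2) * a i : ℝ) : ℂ)) * Uᴴ * (B - A)).trace
        = (diagonal (fun i => ((p * |a i| ^ (p - 2) * a i : ℝ) : ℂ)) *
          (Uᴴ * B * U - Uᴴ * A * U)).trace := by
      rw [mul_assoc, mul_assoc, trace_mul_comm, mul_assoc, ← sub_mul, ← mul_sub]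
    rw [e1, trace] at htr
    have e2 := congrArg Complex.re htr
    rw [Complex.re_sum, Complex.zero_re] at e2
    rw [Finset.sum_comm, ← e2]
    refine Finset.sum_congr rfl fun i _ => ?_
    rw [diag_apply, diagonal_mul, Complex.re_ofReal_mul, Matrix.sub_apply, Complex.sub_re, hUA, hUB,
      conj_diagonal_diag_re, diagonal_apply_eq, Complex.ofReal_re]
    have e3 := sum_normSq_col hW1 i
    calc ∑ j, Complex.normSq ((Vᴴ * U) j i) * (p * |a i| ^ (p - 2) * a i * (b j - a i))
        = p * |a i| ^ (p - 2) * a i * (∑ j, Complex.normSq ((Vᴴ * U) j i) * b j -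
          (∑ j, Complex.normSq ((Vᴴ * U) j i)) * a i) := by
          rw [Finset.sum_mul, ← Finset.sum_sub_distrib, Finset.mul_sum]
          exact Finset.sum_congr rfl fun j _ => by ring
      _ = _ := by rw [e3, one_mul]
  have hSA : schattenPow p A = ∑ j, ∑ i, Complex.normSq ((Vᴴ * U) j i) * |a i| ^ p := by
    rw [schattenPow_conj_diagonal p hU hA, Finset.sum_comm]
    refine Finset.sum_congr rfl fun i _ => ?_
    rw [← Finset.sum_mul, sum_normSq_col hW1, one_mul]
  have hSB : schattenPow p B = ∑ j, ∑ i, Complex.normSq ((Vᴴ * U) j i) * |b j| ^ p := by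
    rw [schattenPow_conj_diagonal p hV hB]
    refine Finset.sum_congr rfl fun j _ => ?_
    rw [← Finset.sum_mul, sum_normSq_row hW2, one_mul]
  rw [← add_zero (schattenPow p A), ← htr', hSA, hSB, Finset.mul_sum, ← Finset.sum_add_distrib,
    ← Finset.sum_add_distrib]
  refine Finset.sum_le_sum fun j _ => ?_
  rw [Finset.mul_sum, ← Finset.sum_add_distrib, ← Finset.sum_add_distrib]
  refine Finset.sum_le_sum fun i _ => ?_
  have h := mul_le_mul_of_nonneg_left (abs_rpow_sub_ge hp1 hp2 (le_max_left |a i| |b j|)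
    (le_max_right |a i| |b j|)) (Complex.normSq_nonneg ((Vᴴ * U) j i))
  rw [hζ, Complex.normSq_mul, Complex.normSq_ofReal]
  linarith

end PinchingConvexity

section Pinching

variable {ι : Type*} [Fintype ι] [DecidableEq ι]

/-- The block diagonal part of a matrix, the blocks being the fibres of `b`. -/
def blockPart {α : Type*} [DecidableEq α] (b : ι → α) (M : Matrix ι ι ℂ) : Matrix ι ι ℂ :=
  of fun i j => if b i = b j then M i j else 0

lemma schattenPow_rpow_add_le_of_trace_eq_zero {p : ℝ} (hp1 : 1 < p) (hp2 : p < 2)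
    {A B U V : Matrix ι ι ℂ} {a b : ι → ℝ} (hU : Uᴴ * U = 1) (hU' : U * Uᴴ = 1)
    (hV : Vᴴ * V = 1) (hV' : V * Vᴴ = 1) (hA : A = U * diagonal (fun i => (a i : ℂ)) * Uᴴ)
    (hB : B = V * diagonal (fun i => (b i : ℂ)) * Vᴴ)
    (htr : (U * diagonal (fun i => ((p * |a i| ^ (p - 2) * a i : ℝ) : ℂ)) * Uᴴ * (B - A)).trace = 0) :
    schattenPow p A ^ (2 / p) + p * (p - 1) / 2 / 4 ^ (2 / p) * schattenPow p (B - A) ^ (2 / p) ≤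
      schattenPow p B ^ (2 / p) := by
  have hp0 : 0 < p := by linarith
  have h := schattenPow_add_le_of_trace_eq_zero hp1 hp2.le hU hU' hV hV' hA hB htr
  set ζ := Vᴴ * (B - A) * U with hζ
  set κ := p * (p - 1) / 2 with hκ
  have hκ0 : 0 ≤ κ := by
    have : 0 ≤ p - 1 := by linarith
    positivity
  set G := ∑ j, ∑ i, Complex.normSq (ζ j i) * max |a i| |b j| ^ (p - 2) with hG
  have hG0 : 0 ≤ G := Finset.sum_nonneg fun j _ => Finset.sum_nonneg fun i _ =>
    mul_nonneg (Complex.normSq_nonneg _) (Real.rpow_nonneg (le_max_of_le_left (abs_nonneg _)) _)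
  set SA := schattenPow p A with hSA
  set SB := schattenPow p B with hSB
  have hSA0 : 0 ≤ SA := schattenPow_nonneg _ _
  have hSB0 : 0 ≤ SB := schattenPow_nonneg _ _
  have hAB : SA ≤ SB := by nlinarith
  have hζ' : ∀ j i, a i = 0 → b j = 0 → ζ j i = 0 := by
    intro j i ha hb
    have e1 : ζ = diagonal (fun i => (b i : ℂ)) * (Vᴴ * U) -
        (Vᴴ * U) * diagonal (fun i => (a i : ℂ)) := by
      rw [hζ, mul_sub, sub_mul]
      congr 1
      · rw [hB]
        calc Vᴴ * (V * diagonal (fun i => (b i : ℂ)) * Vᴴ) * U =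
            (Vᴴ * V) * diagonal (fun i => (b i : ℂ)) * (Vᴴ * U) := by simp only [mul_assoc]
          _ = _ := by rw [hV, one_mul]
      · rw [hA]
        calc Vᴴ * (U * diagonal (fun i => (a i : ℂ)) * Uᴴ) * U =
            Vᴴ * U * diagonal (fun i => (a i : ℂ)) * (Uᴴ * U) := by simp only [mul_assoc]
          _ = _ := by rw [hU, mul_one]
    rw [e1, Matrix.sub_apply, diagonal_mul, mul_diagonal, ha, hb]
    simp
  have hS : schattenPow p (B - A) = schattenPow p ζ := by
    rw [hζ, schattenPow_mul_unitary _ hU',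
      schattenPow_unitary_mul _ (by rwa [conjTranspose_conjTranspose])]
  set ζ₁ : Matrix ι ι ℂ := of fun j i => if |b j| ≤ |a i| then ζ j i else 0 with hζ₁
  set ζ₂ : Matrix ι ι ℂ := of fun j i => if |b j| ≤ |a i| then 0 else ζ j i with hζ₂
  have hadd : ζ = ζ₁ + ζ₂ := by
    ext j i
    simp only [hζ₁, hζ₂, Matrix.add_apply, of_apply]
    split_ifs <;> simp
  have h1 : schattenPow p ζ₁ ≤ G ^ (p / 2) * SA ^ (1 - p / 2) := by
    refine (schattenPow_le_weighted hp0 hp2 ζ₁ (y := fun i => |a i|) (fun i => abs_nonneg _)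
      ?_).trans ?_
    · intro i hi j
      rw [abs_eq_zero] at hi
      simp only [hζ₁, of_apply]
      split_ifs with hle
      · rw [hi, abs_zero, abs_nonpos_iff] at hle
        exact hζ' j i hi hle
      · rfl
    · rw [← schattenPow_conj_diagonal p hU hA]
      refine mul_le_mul_of_nonneg_right (Real.rpow_le_rpow ?_ ?_ (by linarith))
        (Real.rpow_nonneg hSA0 _)
      · exact Finset.sum_nonneg fun j _ => Finset.sum_nonneg fun i _ =>
          mul_nonneg (Complex.normSq_nonneg _) (Real.rpow_nonneg (abs_nonneg _) _)
      · refine Finset.sum_le_sum fun j _ => Finset.sum_le_sum fun i _ => ?_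
        simp only [hζ₁, of_apply]
        split_ifs with hle
        · rw [max_eq_left hle]
        · rw [map_zero, zero_mul]
          exact mul_nonneg (Complex.normSq_nonneg _)
            (Real.rpow_nonneg (le_max_of_le_left (abs_nonneg _)) _)
  have h2 : schattenPow p ζ₂ ≤ G ^ (p / 2) * SB ^ (1 - p / 2) := by
    rw [← schattenPow_conjTranspose]
    refine (schattenPow_le_weighted hp0 hp2 ζ₂ᴴ (y := fun j => |b j|) (fun i => abs_nonneg _)
      ?_).trans ?_
    · intro j hj i
      rw [abs_eq_zero] at hj
      simp only [hζ₂, of_apply, conjTranspose_apply]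
      rw [if_pos]
      · exact star_zero _
      · rw [hj, abs_zero]
        exact abs_nonneg _
    · rw [← schattenPow_conj_diagonal p hV hB]
      refine mul_le_mul_of_nonneg_right (Real.rpow_le_rpow ?_ ?_ (by linarith))
        (Real.rpow_nonneg hSB0 _)
      · exact Finset.sum_nonneg fun j _ => Finset.sum_nonneg fun i _ =>
          mul_nonneg (Complex.normSq_nonneg _) (Real.rpow_nonneg (abs_nonneg _) _)
      · rw [Finset.sum_comm]
        refine Finset.sum_le_sum fun j _ => Finset.sum_le_sum fun i _ => ?_
        simp only [hζ₂, of_apply, conjTranspose_apply, Complex.star_def, Complex.normSq_conj]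
        split_ifs with hle
        · rw [map_zero, zero_mul]
          exact mul_nonneg (Complex.normSq_nonneg _)
            (Real.rpow_nonneg (le_max_of_le_left (abs_nonneg _)) _)
        · rw [max_eq_right (not_le.1 hle).le]
  have h3 : schattenPow p (B - A) ≤ 4 * (G ^ (p / 2) * SB ^ (1 - p / 2)) := by
    rw [hS, hadd]
    refine (schattenPow_add_le hp0 hp2.le ζ₁ ζ₂).trans ?_
    have : G ^ (p / 2) * SA ^ (1 - p / 2) ≤ G ^ (p / 2) * SB ^ (1 - p / 2) :=
      mul_le_mul_of_nonneg_left (Real.rpow_le_rpow hSA0 hAB (by linarith)) (Real.rpow_nonneg hG0 _)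
    linarith
  have h4 : schattenPow p (B - A) ^ (2 / p) ≤ 4 ^ (2 / p) * (G * SB ^ (2 / p - 1)) := by
    refine (Real.rpow_le_rpow (schattenPow_nonneg _ _) h3 (by positivity)).trans (le_of_eq ?_)
    rw [Real.mul_rpow (by norm_num) (by positivity), Real.mul_rpow (by positivity) (by positivity),
      ← Real.rpow_mul hG0, ← Real.rpow_mul hSB0]
    congr 3
    · rw [show p / 2 * (2 / p) = 1 by field_simp, Real.rpow_one]
    · field_simp
  have hexp : 0 < 2 / p - 1 := by
    rw [sub_pos, lt_div_iff₀ hp0]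
    linarith
  have h5 : ∀ x : ℝ, 0 ≤ x → x ^ (2 / p) = x ^ (2 / p - 1) * x := by
    intro x hx
    rcases hx.eq_or_lt with rfl | hx
    · rw [mul_zero, Real.zero_rpow (by positivity)]
    · rw [← Real.rpow_add_one hx.ne', sub_add_cancel]
  have h6 : SA ^ (2 / p) ≤ SB ^ (2 / p - 1) * SA := by
    rw [h5 SA hSA0]
    exact mul_le_mul_of_nonneg_right (Real.rpow_le_rpow hSA0 hAB hexp.le) hSA0
  have h7 : κ / 4 ^ (2 / p) * schattenPow p (B - A) ^ (2 / p) ≤ SB ^ (2 / p - 1) * (κ * G) := by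
    calc κ / 4 ^ (2 / p) * schattenPow p (B - A) ^ (2 / p)
        ≤ κ / 4 ^ (2 / p) * (4 ^ (2 / p) * (G * SB ^ (2 / p - 1))) :=
          mul_le_mul_of_nonneg_left h4 (by positivity)
      _ = _ := by
          have : (4 : ℝ) ^ (2 / p) ≠ 0 := by positivity
          field_simp
  rw [h5 SB hSB0]
  have h8 : SB ^ (2 / p - 1) * (SA + κ * G) ≤ SB ^ (2 / p - 1) * SB :=
    mul_le_mul_of_nonneg_left h (Real.rpow_nonneg hSB0 _)
  linarith

/-- A spectral function of a block diagonal matrix is block diagonal. -/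
lemma conj_diagonal_apply_eq_zero {α : Type*} {b : ι → α} {U D : Matrix ι ι ℂ} {a : ι → ℝ}
    (hU : Uᴴ * U = 1) (hU' : U * Uᴴ = 1) (hD : D = U * diagonal (fun i => (a i : ℂ)) * Uᴴ)
    (hb : ∀ i j, b i ≠ b j → D i j = 0) (f : ℝ → ℝ) {i j : ι} (hij : b i ≠ b j) :
    (U * diagonal (fun i => (f (a i) : ℂ)) * Uᴴ) i j = 0 := by
  classical
  set P : Matrix ι ι ℂ := diagonal fun k => if b k = b i then 1 else 0 with hP
  have hPD : P * D = D * P := by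
    ext k l
    rw [hP, diagonal_mul, mul_diagonal]
    by_cases hkl : b k = b l
    · rw [hkl, mul_comm]
    · rw [hb k l hkl, mul_zero, zero_mul]
  set Q := Uᴴ * P * U with hQ
  have hQa : Q * diagonal (fun i => (a i : ℂ)) = diagonal (fun i => (a i : ℂ)) * Q := by
    calc Q * diagonal (fun i => (a i : ℂ))
        = Uᴴ * P * (U * diagonal (fun i => (a i : ℂ)) * (Uᴴ * U)) := by
          rw [hU, mul_one, hQ, mul_assoc]
      _ = Uᴴ * (P * D) * U := by rw [hD]; simp only [mul_assoc]
      _ = (Uᴴ * U) * diagonal (fun i => (a i : ℂ)) * (Uᴴ * P * U) := by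
          rw [hPD, hD]; simp only [mul_assoc]
      _ = _ := by rw [hU, one_mul]
  have hQf : Q * diagonal (fun i => (f (a i) : ℂ)) = diagonal (fun i => (f (a i) : ℂ)) * Q := by
    ext k l
    have h1 := congrFun (congrFun hQa k) l
    rw [mul_diagonal, diagonal_mul] at h1 ⊢
    by_cases hkl : a k = a l
    · rw [hkl, mul_comm]
    · have : Q k l * ((a l : ℂ) - a k) = 0 := by rw [mul_sub, h1]; ring
      rcases mul_eq_zero.1 this with h | h
      · rw [h, zero_mul, mul_zero]
      · exact absurd (by exact_mod_cast (sub_eq_zero.1 h).symm) hkl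
  have hPf : P * (U * diagonal (fun i => (f (a i) : ℂ)) * Uᴴ) =
      (U * diagonal (fun i => (f (a i) : ℂ)) * Uᴴ) * P := by
    calc P * (U * diagonal (fun i => (f (a i) : ℂ)) * Uᴴ)
        = (U * Uᴴ) * P * (U * diagonal (fun i => (f (a i) : ℂ)) * Uᴴ) := by rw [hU', one_mul]
      _ = U * (Q * diagonal (fun i => (f (a i) : ℂ))) * Uᴴ := by rw [hQ]; simp only [mul_assoc]
      _ = (U * diagonal (fun i => (f (a i) : ℂ)) * Uᴴ) * P * (U * Uᴴ) := by
          rw [hQf, hQ]; simp only [mul_assoc]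
      _ = _ := by rw [hU', mul_one]
  have h1 := congrFun (congrFun hPf i) j
  rw [hP, diagonal_mul, mul_diagonal, if_pos rfl, if_neg fun h => hij h.symm] at h1
  simpa using h1

/-- Uniform convexity inequality for the block diagonal part, `1 < p < 2`. -/
lemma schattenPow_blockPart_of_one_lt {p : ℝ} (hp1 : 1 < p) (hp2 : p < 2) {α : Type*}
    [DecidableEq α] (b : ι → α) (T : Matrix ι ι ℂ) :
    schattenPow p (blockPart b T) ^ (2 / p) + p * (p - 1) / 2 / 4 ^ (2 / p) *
      schattenPow p (T - blockPart b T) ^ (2 / p) ≤ schattenPow p T ^ (2 / p) := by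
  set D := blockPart b T with hD
  have hH : ∀ X : Matrix ι ι ℂ, (fromBlocks 0 X Xᴴ 0).IsHermitian := by
    intro X
    rw [IsHermitian, fromBlocks_conjTranspose]
    simp
  have hS : ∀ X : Matrix ι ι ℂ, schattenPow p (fromBlocks 0 X Xᴴ 0) = 2 * schattenPow p X := by
    intro X
    rw [schattenPow_fromBlocks_zero, schattenPow_conjTranspose, two_mul]
  obtain ⟨U, a, hU, hU', hA, -⟩ := (hH D).exists_conj_diagonal
  obtain ⟨V, c, hV, hV', hB, -⟩ := (hH T).exists_conj_diagonal
  have hsub : fromBlocks 0 T Tᴴ 0 - fromBlocks 0 D Dᴴ 0 = fromBlocks 0 (T - D) (T - D)ᴴ 0 := by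
    rw [sub_eq_add_neg, fromBlocks_neg, fromBlocks_add, conjTranspose_sub]
    simp [sub_eq_add_neg]
  have h := schattenPow_rpow_add_le_of_trace_eq_zero hp1 hp2 hU hU' hV hV' hA hB ?_
  · rw [hsub, hS, hS, hS, Real.mul_rpow zero_le_two (schattenPow_nonneg _ _),
      Real.mul_rpow zero_le_two (schattenPow_nonneg _ _),
      Real.mul_rpow zero_le_two (schattenPow_nonneg _ _), mul_left_comm, ← mul_add] at h
    exact le_of_mul_le_mul_left h (by positivity)
  · rw [hsub, trace]
    refine Finset.sum_eq_zero fun k _ => ?_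
    rw [diag_apply, mul_apply]
    refine Finset.sum_eq_zero fun l _ => ?_
    by_cases hkl : Sum.elim b b k = Sum.elim b b l
    · rw [mul_eq_zero]
      right
      rcases k with k | k <;> rcases l with l | l <;> simp at hkl ⊢ <;>
        simp [hD, blockPart, hkl]
    · rw [conj_diagonal_apply_eq_zero (b := Sum.elim b b) hU hU' hA ?_
        (fun t => p * |t| ^ (p - 2) * t) hkl, zero_mul]
      intro k l hkl
      rcases k with k | k <;> rcases l with l | l <;> simp at hkl ⊢ <;>
        simp [hD, blockPart, hkl, Ne.symm hkl]

lemma schattenPow_blockPart_two {α : Type*} [DecidableEq α] (b : ι → α) (T : Matrix ι ι ℂ) :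
    schattenPow 2 (blockPart b T) + schattenPow 2 (T - blockPart b T) = schattenPow 2 T := by
  simp only [schattenPow_two, ← Finset.sum_add_distrib]
  refine Finset.sum_congr rfl fun i _ => Finset.sum_congr rfl fun j _ => ?_
  by_cases h : b i = b j <;> simp [blockPart, h]

end Pinching

section Triangular

lemma Matrix.PosDef.exists_upperTriangular {m : ℕ} {Q : Matrix (Fin m) (Fin m) ℂ} (hQ : Q.PosDef) :
    ∃ B : Matrix (Fin m) (Fin m) ℂ, Bᴴ * B = Q ∧ BlockTriangular B id := by
  have hd : (LDL.diag hQ).PosSemidef := by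
    rw [LDL.diag_eq_lowerInv_conj]
    exact hQ.posSemidef.mul_mul_conjTranspose_same _
  have hd' : ∀ i, 0 ≤ LDL.diagEntries hQ i := fun i => by
    simpa [LDL.diag] using hd.diag_nonneg (i := i)
  have hlow : BlockTriangular (LDL.lower hQ) OrderDual.toDual :=
    blockTriangular_inv_of_blockTriangular fun i j hij => LDL.lowerInv_triangular hQ hij
  refine ⟨diagonal (fun i => (√(LDL.diagEntries hQ i).re : ℂ)) * (LDL.lower hQ)ᴴ, ?_, ?_⟩
  · have e : (diagonal (fun i => (√(LDL.diagEntries hQ i).re : ℂ)) : Matrix (Fin m) (Fin m) ℂ)ᴴ *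
        diagonal (fun i => (√(LDL.diagEntries hQ i).re : ℂ)) = LDL.diag hQ := by
      rw [diagonal_conjTranspose, diagonal_mul_diagonal, LDL.diag]
      congr 1
      ext1 i
      have h := Complex.le_def.1 (hd' i)
      rw [Pi.star_apply, Complex.star_def, Complex.conj_ofReal, ← Complex.ofReal_mul,
        Real.mul_self_sqrt h.1]
      exact Complex.ext rfl h.2
    rw [conjTranspose_mul, conjTranspose_conjTranspose]
    calc LDL.lower hQ * (diagonal fun i => (√(LDL.diagEntries hQ i).re : ℂ))ᴴ *
          (diagonal (fun i => (√(LDL.diagEntries hQ i).re : ℂ)) * (LDL.lower hQ)ᴴ)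
        = LDL.lower hQ * ((diagonal fun i => (√(LDL.diagEntries hQ i).re : ℂ))ᴴ *
          diagonal (fun i => (√(LDL.diagEntries hQ i).re : ℂ))) * (LDL.lower hQ)ᴴ := by
          simp only [mul_assoc]
      _ = Q := by rw [e, LDL.lower_conj_diag]
  · intro i j hij
    rw [diagonal_mul, conjTranspose_apply, hlow hij, star_zero, mul_zero]

variable {ι : Type*} [Fintype ι] [DecidableEq ι] {α : Type*} [LinearOrder α]

lemma blockPart_mul {b : ι → α} {A B : Matrix ι ι ℂ} (hA : BlockTriangular A b)
    (hB : BlockTriangular B b) : blockPart b (A * B) = blockPart b A * blockPart b B := by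
  ext i j
  simp only [blockPart, of_apply, mul_apply]
  split_ifs with hij
  · refine Finset.sum_congr rfl fun k _ => ?_
    rcases lt_trichotomy (b i) (b k) with h | h | h
    · rw [hB (hij ▸ h), mul_zero, if_neg h.ne, zero_mul]
    · rw [if_pos h, if_pos (h ▸ hij)]
    · rw [hA h, zero_mul, if_neg h.ne', zero_mul]
  · refine (Finset.sum_eq_zero fun k _ => ?_).symm
    by_cases h : b i = b k
    · rw [if_neg (c := b k = b j) (fun h' => hij (h.trans h')), mul_zero]
    · rw [if_neg h, zero_mul]

lemma continuous_blockPart (b : ι → α) :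
    Continuous (blockPart b : Matrix ι ι ℂ → Matrix ι ι ℂ) := by
  refine continuous_matrix fun i j => ?_
  simp only [blockPart, of_apply]
  split_ifs
  · exact continuous_id.matrix_elem i j
  · exact continuous_const

/-- A triangular matrix factors as `T = A B` with triangular factors satisfying
`‖A‖_2^2 = ‖B‖_r^r = ‖T‖_p^p`, where `1/p = 1/2 + 1/r`. -/
lemma exists_factorization {p : ℝ} (hp0 : 0 < p) (hp2 : p < 2) {m : ℕ} {b : Fin m → α}
    (hb : Monotone b) {T : Matrix (Fin m) (Fin m) ℂ} (hT : BlockTriangular T b)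
    (hdet : T.det ≠ 0) :
    ∃ A B : Matrix (Fin m) (Fin m) ℂ, T = A * B ∧ BlockTriangular A b ∧ BlockTriangular B b ∧
      schattenPow 2 A = schattenPow p T ∧ schattenPow (2 * p / (2 - p)) B = schattenPow p T := by
  have h2p : 0 < 2 - p := by linarith
  obtain ⟨V, x, hV, hV', hx0, hx⟩ := (posSemidef_conjTranspose_mul_self T).exists_conj_diagonal
  have hdetx : ∀ i, x i ≠ 0 := by
    intro i hi
    have h1 : (Tᴴ * T).det = 0 := by
      rw [hx, det_mul, det_mul, det_diagonal, Finset.prod_eq_zero (Finset.mem_univ i) (by simp [hi])]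
      simp
    rw [det_mul, det_conjTranspose] at h1
    rcases mul_eq_zero.1 h1 with h | h
    · exact hdet (star_eq_zero.1 h)
    · exact hdet h
  have hxpos : ∀ i, 0 < x i := fun i => lt_of_le_of_ne (hx0 i) (hdetx i).symm
  set y : Fin m → ℝ := fun i => x i ^ (1 - p / 2) with hy
  have hypos : ∀ i, 0 < y i := fun i => Real.rpow_pos_of_pos (hxpos i) _
  set Q := V * diagonal (fun i => (y i : ℂ)) * Vᴴ with hQ
  set R := V * diagonal (fun i => ((y i)⁻¹ : ℂ)) * Vᴴ with hR
  have hQR : Q * R = 1 := by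
    calc Q * R = V * (diagonal (fun i => (y i : ℂ)) * (Vᴴ * V) *
          diagonal (fun i => ((y i)⁻¹ : ℂ))) * Vᴴ := by simp only [hQ, hR, mul_assoc]
      _ = V * 1 * Vᴴ := by
          rw [hV, mul_one, diagonal_mul_diagonal, ← diagonal_one]
          congr 3
          ext1 i
          exact mul_inv_cancel₀ (by exact_mod_cast (hypos i).ne')
      _ = 1 := by rw [mul_one, hV']
  have hQpos : Q.PosDef := by
    refine (posSemidef_conj_diagonal (fun i => (hypos i).le) hQ).posDef_iff_isUnit.2 ?_
    exact IsUnit.of_mul_eq_one _ hQR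
  obtain ⟨B, hB, hBt⟩ := hQpos.exists_upperTriangular
  have hBu : IsUnit B.det := by
    have : IsUnit Q.det := (isUnit_iff_isUnit_det _).1 (IsUnit.of_mul_eq_one _ hQR)
    rw [← hB, det_mul] at this
    exact isUnit_of_mul_isUnit_right this
  have hBb : BlockTriangular B b := fun i j hij => hBt (by
    by_contra h
    exact absurd (hb (not_lt.1 h)) (not_le.2 hij))
  have hBinv : BlockTriangular B⁻¹ b := by
    let := invertibleOfIsUnitDet B hBu
    exact blockTriangular_inv_of_blockTriangular hBb
  refine ⟨T * B⁻¹, B, ?_, hT.mul hBinv, hBb, ?_, ?_⟩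
  · rw [mul_assoc, nonsing_inv_mul _ hBu, mul_one]
  · have hRB : B⁻¹ * (B⁻¹)ᴴ = R := by
      have h1 : Q * (B⁻¹ * (B⁻¹)ᴴ) = 1 := by
        calc Q * (B⁻¹ * (B⁻¹)ᴴ) = Bᴴ * (B * B⁻¹) * (B⁻¹)ᴴ := by rw [← hB]; simp only [mul_assoc]
          _ = (B⁻¹ * B)ᴴ := by rw [mul_nonsing_inv _ hBu, mul_one, conjTranspose_mul]
          _ = 1 := by rw [nonsing_inv_mul _ hBu, conjTranspose_one]
      exact (left_inv_eq_right_inv (mul_eq_one_comm.1 hQR) h1).symm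
    have h2 : schattenPow 2 (T * B⁻¹) = ((Tᴴ * T) * R).trace.re := by
      rw [schattenPow, div_self two_ne_zero, tracePow_one (isHermitian_conjTranspose_mul_self _),
        conjTranspose_mul, ← hRB, mul_assoc, trace_mul_comm]
      simp only [mul_assoc]
    have h3 : (Tᴴ * T) * R = V * diagonal (fun i => ((x i ^ (p / 2) : ℝ) : ℂ)) * Vᴴ := by
      calc (Tᴴ * T) * R = V * (diagonal (fun i => (x i : ℂ)) * (Vᴴ * V) *
            diagonal (fun i => ((y i)⁻¹ : ℂ))) * Vᴴ := by rw [hx]; simp only [hR, mul_assoc]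
        _ = _ := by
            rw [hV, mul_one, diagonal_mul_diagonal]
            congr 3
            ext1 i
            rw [← Complex.ofReal_inv, ← Complex.ofReal_mul, hy]
            congr 1
            simp only
            rw [← Real.rpow_neg (hx0 i), ← Real.rpow_one_add' (hx0 i) (by linarith)]
            congr 1
            ring
    rw [h2, h3, trace_mul_comm, ← mul_assoc, hV, one_mul, trace_diagonal, Complex.re_sum,
      schattenPow, tracePow_conj_diagonal hV hx]
    simp
  · rw [schattenPow, schattenPow, hB, tracePow_conj_diagonal hV hQ, tracePow_conj_diagonal hV hx]
    refine Finset.sum_congr rfl fun i _ => ?_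
    rw [← Real.rpow_mul (hx0 i)]
    congr 1
    field_simp

lemma schattenPow_mul_rpow_le {p : ℝ} (hp0 : 0 < p) (hp2 : p < 2) (A B : Matrix ι ι ℂ) :
    schattenPow p (A * B) ^ (2 / p) ≤
      schattenPow 2 A * schattenPow (2 * p / (2 - p)) B ^ (2 / (2 * p / (2 - p))) := by
  have h2p : 0 < 2 - p := by linarith
  have hA := schattenPow_nonneg 2 A
  have hB := schattenPow_nonneg (2 * p / (2 - p)) B
  refine (Real.rpow_le_rpow (schattenPow_nonneg _ _) (schattenPow_mul_le hp0 hp2 A B)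
    (by positivity)).trans (le_of_eq ?_)
  rw [Real.mul_rpow (by positivity) (by positivity), ← Real.rpow_mul hA, ← Real.rpow_mul hB,
    show p / 2 * (2 / p) = 1 by field_simp, Real.rpow_one]
  congr 2
  field_simp

lemma schattenPow_add_rpow_le {p : ℝ} (hp0 : 0 < p) (hp2 : p ≤ 2) (X Y : Matrix ι ι ℂ) :
    schattenPow p (X + Y) ^ (2 / p) ≤
      4 ^ (2 / p) * (schattenPow p X ^ (2 / p) + schattenPow p Y ^ (2 / p)) := by
  have hX := schattenPow_nonneg p X
  have hY := schattenPow_nonneg p Y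
  have h : schattenPow p (X + Y) ≤ 4 * max (schattenPow p X) (schattenPow p Y) := by
    have := schattenPow_add_le hp0 hp2 X Y
    linarith [le_max_left (schattenPow p X) (schattenPow p Y),
      le_max_right (schattenPow p X) (schattenPow p Y)]
  refine (Real.rpow_le_rpow (schattenPow_nonneg _ _) h (by positivity)).trans ?_
  rw [Real.mul_rpow (by norm_num) (le_max_of_le_left hX)]
  refine mul_le_mul_of_nonneg_left ?_ (by positivity)
  rcases max_cases (schattenPow p X) (schattenPow p Y) with h | h <;> rw [h.1]
  · linarith [Real.rpow_nonneg hY (2 / p)]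
  · linarith [Real.rpow_nonneg hX (2 / p)]

/-- Uniform convexity for block triangular matrices with constant `δ`. -/
def TriangularConvexity (p δ : ℝ) : Prop :=
  ∀ (m : ℕ) (b : Fin m → ℕ) (_ : Monotone b) (T : Matrix (Fin m) (Fin m) ℂ)
    (_ : BlockTriangular T b),
    schattenPow p (blockPart b T) ^ (2 / p) + δ * schattenPow p (T - blockPart b T) ^ (2 / p) ≤
      schattenPow p T ^ (2 / p)

lemma triangularConvexity_of_det_ne_zero {p δ : ℝ} (hp0 : 0 < p) (hp2 : p ≤ 2)
    (h : ∀ (m : ℕ) (b : Fin m → ℕ) (_ : Monotone b) (T : Matrix (Fin m) (Fin m) ℂ)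
      (_ : BlockTriangular T b) (_ : T.det ≠ 0),
      schattenPow p (blockPart b T) ^ (2 / p) + δ * schattenPow p (T - blockPart b T) ^ (2 / p) ≤
        schattenPow p T ^ (2 / p)) : TriangularConvexity p δ := by
  intro m b hb T hT
  have hev : ∀ᶠ z : ℂ in nhdsWithin 0 {0}ᶜ, (T + z • (1 : Matrix (Fin m) (Fin m) ℂ)).det ≠ 0 := by
    have hfin : {z : ℂ | (T + z • (1 : Matrix (Fin m) (Fin m) ℂ)).det = 0}.Finite := by
      refine ((-T).charpoly.roots.toFinset.finite_toSet).subset fun z hz => ?_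
      rw [Finset.mem_coe, Multiset.mem_toFinset, Polynomial.mem_roots (charpoly_monic _).ne_zero,
        Polynomial.IsRoot.def, eval_charpoly]
      rw [Set.mem_ofPred_eq] at hz
      rw [← hz, sub_neg_eq_add, add_comm, scalar_apply, smul_one_eq_diagonal]
    exact nhdsNE_le_cofinite 0 hfin.compl_mem_cofinite
  have hN : Continuous fun X : Matrix (Fin m) (Fin m) ℂ => schattenPow p X ^ (2 / p) :=
    (continuous_schattenPow hp0 hp2).rpow_const fun _ => Or.inr (by positivity)
  have hT' : Continuous fun z : ℂ => T + z • (1 : Matrix (Fin m) (Fin m) ℂ) := by fun_prop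
  have hD := (continuous_blockPart b).comp hT'
  have hc : Continuous fun z : ℂ => schattenPow p (blockPart b (T + z • 1)) ^ (2 / p) +
      δ * schattenPow p (T + z • 1 - blockPart b (T + z • 1)) ^ (2 / p) :=
    (hN.comp hD).add ((hN.comp (hT'.sub hD)).const_mul δ)
  have hc' : Continuous fun z : ℂ => schattenPow p (T + z • 1) ^ (2 / p) := hN.comp hT'
  have h1 := hc.tendsto 0
  have h2 := hc'.tendsto 0
  rw [zero_smul, add_zero] at h1 h2
  refine le_of_tendsto_of_tendsto (b := nhdsWithin 0 {0}ᶜ) (h1.mono_left nhdsWithin_le_nhds)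
    (h2.mono_left nhdsWithin_le_nhds) ?_
  filter_upwards [hev] with z hz
  refine h m b hb _ (hT.add ?_) hz
  rw [smul_one_eq_diagonal]
  exact blockTriangular_diagonal _

lemma TriangularConvexity.of_holder {p δ : ℝ} (hp0 : 0 < p) (hp1 : p ≤ 1) (hδ0 : 0 < δ)
    (hδ1 : δ ≤ 1) (h : TriangularConvexity (2 * p / (2 - p)) δ) :
    TriangularConvexity p (δ / 4 ^ (2 / p)) := by
  have hp2 : p < 2 := by linarith
  have h2p : 0 < 2 - p := by linarith
  refine triangularConvexity_of_det_ne_zero hp0 hp2.le fun m b hb T hT hdet => ?_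
  obtain ⟨A, B, hTAB, hA, hB, hSA, hSB⟩ := exists_factorization hp0 hp2 hb hT hdet
  set r := 2 * p / (2 - p) with hr
  have hτ := schattenPow_nonneg p T
  have hBr := h m b hb B hB
  have hA2 := schattenPow_blockPart_two b A
  set DA := blockPart b A with hDA
  set DB := blockPart b B with hDB
  have hprod : schattenPow p T ^ (2 / p) = schattenPow 2 A * schattenPow r B ^ (2 / r) := by
    rw [hSA, hSB, ← Real.rpow_one_add' hτ (by positivity)]
    congr 1
    rw [hr]
    field_simp
    ring
  have hD : blockPart b T = DA * DB := by rw [hTAB, blockPart_mul hA hB]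
  have hTD : T - blockPart b T = (A - DA) * B + DA * (B - DB) := by
    rw [hD, hTAB, sub_mul, mul_sub, sub_add_sub_cancel]
  have h1 : schattenPow p (blockPart b T) ^ (2 / p) ≤
      schattenPow 2 DA * schattenPow r DB ^ (2 / r) := by
    rw [hD]
    exact schattenPow_mul_rpow_le hp0 hp2 DA DB
  have h2 : schattenPow p (T - blockPart b T) ^ (2 / p) ≤ 4 ^ (2 / p) *
      (schattenPow 2 (A - DA) * schattenPow r B ^ (2 / r) +
        schattenPow 2 DA * schattenPow r (B - DB) ^ (2 / r)) := by
    rw [hTD]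
    refine (schattenPow_add_rpow_le hp0 hp2.le _ _).trans
      (mul_le_mul_of_nonneg_left ?_ (by positivity))
    exact add_le_add (schattenPow_mul_rpow_le hp0 hp2 _ _) (schattenPow_mul_rpow_le hp0 hp2 _ _)
  have n1 : 0 ≤ schattenPow 2 (A - DA) := schattenPow_nonneg _ _
  have n2 : 0 ≤ schattenPow 2 DA := schattenPow_nonneg _ _
  have n3 : 0 ≤ schattenPow r B ^ (2 / r) := Real.rpow_nonneg (schattenPow_nonneg _ _) _
  have h3 : δ / 4 ^ (2 / p) * schattenPow p (T - blockPart b T) ^ (2 / p) ≤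
      δ * (schattenPow 2 (A - DA) * schattenPow r B ^ (2 / r)) +
        schattenPow 2 DA * (δ * schattenPow r (B - DB) ^ (2 / r)) := by
    refine (mul_le_mul_of_nonneg_left h2 (by positivity)).trans (le_of_eq ?_)
    have : (4 : ℝ) ^ (2 / p) ≠ 0 := by positivity
    field_simp
  have h4 : δ * (schattenPow 2 (A - DA) * schattenPow r B ^ (2 / r)) ≤
      schattenPow 2 (A - DA) * schattenPow r B ^ (2 / r) :=
    mul_le_of_le_one_left (mul_nonneg n1 n3) hδ1
  have h5 := mul_le_mul_of_nonneg_left hBr n2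
  rw [hprod, ← hA2]
  nlinarith

lemma exists_triangularConvexity {p : ℝ} (hp0 : 0 < p) (hp2 : p ≤ 2) :
    ∃ δ, 0 < δ ∧ δ ≤ 1 ∧ TriangularConvexity p δ := by
  have hbase : ∀ p : ℝ, 1 < p → p ≤ 2 → ∃ δ, 0 < δ ∧ δ ≤ 1 ∧ TriangularConvexity p δ := by
    intro p hp1 hp2
    rcases hp2.eq_or_lt with rfl | hp2
    · refine ⟨1, one_pos, le_rfl, fun m b _ T _ => ?_⟩
      rw [div_self two_ne_zero, Real.rpow_one, Real.rpow_one, Real.rpow_one, one_mul,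
        schattenPow_blockPart_two]
    · have hp1' : 0 < p - 1 := by linarith
      have hp0 : 0 < p := by linarith
      refine ⟨p * (p - 1) / 2 / 4 ^ (2 / p), by positivity, ?_,
        fun m b _ T _ => schattenPow_blockPart_of_one_lt hp1 hp2 b T⟩
      have : (1 : ℝ) ≤ 4 ^ (2 / p) := Real.one_le_rpow (by norm_num) (by positivity)
      rw [div_le_one (by positivity)]
      nlinarith
  have hind : ∀ (k : ℕ) (p : ℝ), 0 < p → p ≤ 2 → 1 / p < 1 + k / 2 →
      ∃ δ, 0 < δ ∧ δ ≤ 1 ∧ TriangularConvexity p δ := by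
    intro k
    induction k with
    | zero =>
      intro p hp0 hp2 hk
      refine hbase p ?_ hp2
      rw [div_lt_iff₀ hp0] at hk
      simpa using hk
    | succ k ih =>
      intro p hp0 hp2 hk
      rcases lt_or_ge 1 p with hp1 | hp1
      · exact hbase p hp1 hp2
      · have h2p : 0 < 2 - p := by linarith
        obtain ⟨δ, hδ0, hδ1, hδ⟩ := ih (2 * p / (2 - p)) (by positivity)
          (by rw [div_le_iff₀ h2p]; linarith) (by
            have : 1 / (2 * p / (2 - p)) = 1 / p - 1 / 2 := by field_simp
            rw [this]
            push_cast at hk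
            linarith)
        refine ⟨δ / 4 ^ (2 / p), by positivity, ?_, hδ.of_holder hp0 hp1 hδ0 hδ1⟩
        have : (1 : ℝ) ≤ 4 ^ (2 / p) := Real.one_le_rpow (by norm_num) (by positivity)
        rw [div_le_one (by positivity)]
        linarith
  obtain ⟨k, hk⟩ := exists_nat_gt (2 / p)
  refine hind k p hp0 hp2 ?_
  have : 1 / p = 2 / p / 2 := by ring
  rw [this]
  linarith

end Triangular

section RiemannSum

lemma tendsto_riemann_sum {k : ℝ → ℝ} (hk : Continuous k) :
    Filter.Tendsto (fun N : ℕ => (∑ l ∈ Finset.range N, k (l / N)) / N) Filter.atTop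
      (nhds (∫ x in (0:ℝ)..1, k x)) := by
  rw [Metric.tendsto_atTop]
  intro ε hε
  have hu := isCompact_Icc.uniformContinuousOn_of_continuous (s := Set.Icc (0:ℝ) 1)
    hk.continuousOn
  rw [Metric.uniformContinuousOn_iff] at hu
  obtain ⟨η, hη, hη'⟩ := hu (ε / 2) (by positivity)
  obtain ⟨M, hM⟩ := exists_nat_gt (1 / η)
  refine ⟨M + 1, fun N hN => ?_⟩
  have hN0 : (0 : ℝ) < N := by
    have : 0 < N := by lia
    exact_mod_cast this
  have hNη : 1 / (N : ℝ) < η := by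
    rw [div_lt_comm₀ hN0 hη]
    refine hM.trans_le ?_
    exact_mod_cast (by lia : M ≤ N)
  have hintegral : ∫ x in (0:ℝ)..1, k x =
      ∑ l ∈ Finset.range N, ∫ x in ((l : ℝ) / N)..(((l + 1 : ℕ) : ℝ) / N), k x := by
    rw [intervalIntegral.sum_integral_adjacent_intervals (a := fun l : ℕ => (l : ℝ) / N)
      fun l _ => hk.intervalIntegrable _ _]
    simp [hN0.ne']
  rw [hintegral, Finset.sum_div, Real.dist_eq, ← Finset.sum_sub_distrib]
  have hterm : ∀ l ∈ Finset.range N, |k (l / N) / N -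
      ∫ x in ((l : ℝ) / N)..(((l + 1 : ℕ) : ℝ) / N), k x| ≤ ε / 2 * (1 / N) := by
    intro l hl
    rw [Finset.mem_range] at hl
    have hlen : ((l + 1 : ℕ) : ℝ) / N - (l : ℝ) / N = 1 / N := by
      push_cast
      ring
    have hle : (l : ℝ) / N ≤ ((l + 1 : ℕ) : ℝ) / N := by
      have : 0 < 1 / (N : ℝ) := by positivity
      linarith
    have hle1 : ((l + 1 : ℕ) : ℝ) / N ≤ 1 := by
      rw [div_le_one hN0]
      exact_mod_cast hl
    have hc : k (l / N) / N = ∫ _ in ((l : ℝ) / N)..(((l + 1 : ℕ) : ℝ) / N), k (l / N) := by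
      rw [intervalIntegral.integral_const, hlen, smul_eq_mul]
      ring
    rw [hc, ← intervalIntegral.integral_sub intervalIntegrable_const
      (hk.intervalIntegrable _ _), ← Real.norm_eq_abs, ← abs_of_pos (show 0 < 1 / (N : ℝ) by
        positivity), ← hlen]
    refine intervalIntegral.norm_integral_le_of_norm_le_const fun x hx => ?_
    rw [Set.uIoc_of_le hle] at hx
    have h0 : (0 : ℝ) ≤ l / N := by positivity
    rw [← dist_eq_norm]
    refine (hη' _ ⟨h0, hle.trans hle1⟩ x ⟨h0.trans hx.1.le, hx.2.trans hle1⟩ ?_).le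
    rw [dist_comm, Real.dist_eq, abs_of_pos (by linarith [hx.1])]
    linarith [hx.2]
  calc |∑ l ∈ Finset.range N, (k (l / N) / N -
        ∫ x in ((l : ℝ) / N)..(((l + 1 : ℕ) : ℝ) / N), k x)|
      ≤ ∑ l ∈ Finset.range N, |k (l / N) / N -
        ∫ x in ((l : ℝ) / N)..(((l + 1 : ℕ) : ℝ) / N), k x| := Finset.abs_sum_le_sum_abs _ _
    _ ≤ ∑ l ∈ Finset.range N, ε / 2 * (1 / N) := Finset.sum_le_sum hterm
    _ = ε / 2 := by
        rw [Finset.sum_const, Finset.card_range, nsmul_eq_mul]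
        field_simp
    _ < ε := by linarith

/-- The normalised integral over the unit circle. -/
noncomputable def circleMean (g : ℂ → ℝ) : ℝ :=
  (1 / (2 * Real.pi)) * ∫ t in (0:ℝ)..(2 * Real.pi), g (Complex.exp (Complex.I * t))

lemma tendsto_sum_stdAddChar {g : ℂ → ℝ} (hg : Continuous g) :
    Filter.Tendsto (fun N : ℕ => (∑ l : ZMod (N + 1), g (ZMod.stdAddChar l)) / (N + 1))
      Filter.atTop (nhds (circleMean g)) := by
  have hpi : (2 * Real.pi) ≠ 0 := by positivity
  have h := (tendsto_riemann_sum (k := fun x => g (Complex.exp (Complex.I * (2 * Real.pi * x : ℝ))))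
    (by fun_prop)).comp (Filter.tendsto_add_atTop_nat 1)
  have e : ∫ x in (0:ℝ)..1, g (Complex.exp (Complex.I * (2 * Real.pi * x : ℝ))) =
      circleMean g := by
    rw [circleMean, intervalIntegral.integral_comp_mul_left
      (fun t : ℝ => g (Complex.exp (Complex.I * t))) hpi, mul_zero, mul_one, smul_eq_mul, one_div]
  rw [e] at h
  refine h.congr fun N => ?_
  simp only [Function.comp_apply]
  push_cast
  congr 1
  refine Finset.sum_bij' (fun l _ => (l : ZMod (N + 1))) (fun l _ => l.val) (by simp)
    (fun l _ => Finset.mem_range.2 l.val_lt)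
    (fun l hl => ZMod.val_cast_of_lt (Finset.mem_range.1 hl)) (fun l _ => ZMod.natCast_zmod_val l)
    fun l _ => ?_
  have := ZMod.stdAddChar_coe (N := N + 1) l
  rw [Int.cast_natCast] at this
  rw [this]
  congr 2
  push_cast
  ring

end RiemannSum

section Toeplitz

lemma TriangularConvexity.apply {p δ : ℝ} (h : TriangularConvexity p δ) {ι : Type*} [Fintype ι]
    [DecidableEq ι] (b : ι → ℕ) {T : Matrix ι ι ℂ} (hT : BlockTriangular T b) :
    schattenPow p (blockPart b T) ^ (2 / p) + δ * schattenPow p (T - blockPart b T) ^ (2 / p) ≤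
      schattenPow p T ^ (2 / p) := by
  set e₀ := Fintype.equivFin ι
  set e : ι ≃ Fin (Fintype.card ι) := e₀.trans (Tuple.sort (b ∘ e₀.symm)).symm with he
  have hmono : Monotone (b ∘ e.symm) := Tuple.monotone_sort (b ∘ e₀.symm)
  have h1 := h _ (b ∘ e.symm) hmono (reindex e e T) (hT.submatrix (f := e.symm))
  have h2 : blockPart (b ∘ e.symm) (reindex e e T) = reindex e e (blockPart b T) := rfl
  have h3 : reindex e e T - reindex e e (blockPart b T) = reindex e e (T - blockPart b T) := rfl
  rwa [h2, h3, schattenPow_reindex, schattenPow_reindex, schattenPow_reindex] at h1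

variable {n : ℕ} (N : ℕ) [NeZero N]

/-- The upper triangular block Toeplitz matrix with blocks `c (j - i)`. -/
def blockToeplitz (c : ℕ → Matrix (Fin n) (Fin n) ℂ) :
    Matrix (Fin n × ZMod N) (Fin n × ZMod N) ℂ :=
  of fun x y => if x.2.val ≤ y.2.val then c (y.2.val - x.2.val) x.1 y.1 else 0

/-- The block circulant matrix with blocks `c ((j - i) mod N)`. -/
def blockCirculant (c : ℕ → Matrix (Fin n) (Fin n) ℂ) :
    Matrix (Fin n × ZMod N) (Fin n × ZMod N) ℂ :=
  of fun x y => c (y.2 - x.2).val x.1 y.1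

/-- The polynomial with matrix coefficients `c k`, `k < d`. -/
noncomputable def matrixPoly (d : ℕ) (c : ℕ → Matrix (Fin n) (Fin n) ℂ) (z : ℂ) :
    Matrix (Fin n) (Fin n) ℂ :=
  ∑ k ∈ Finset.range d, z ^ k • c k

lemma continuous_matrixPoly (d : ℕ) (c : ℕ → Matrix (Fin n) (Fin n) ℂ) :
    Continuous (matrixPoly d c) := by
  unfold matrixPoly
  fun_prop

/-- The normalised discrete Fourier transform acting on blocks. -/
noncomputable def blockDFT (n : ℕ) : Matrix (Fin n × ZMod N) (Fin n × ZMod N) ℂ :=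
  of fun x y => if x.1 = y.1 then ((√N)⁻¹ : ℂ) * ZMod.stdAddChar (x.2 * y.2) else 0

lemma blockDFT_conjTranspose_mul (n : ℕ) : (blockDFT N n)ᴴ * blockDFT N n = 1 := by
  have hN : ((√(N : ℝ) : ℝ) : ℂ) * ((√(N : ℝ) : ℝ) : ℂ) = N := by
    rw [← Complex.ofReal_mul, Real.mul_self_sqrt (Nat.cast_nonneg N), Complex.ofReal_natCast]
  have hN0 : (N : ℂ) ≠ 0 := by exact_mod_cast NeZero.ne N
  ext ⟨a, l⟩ ⟨b, l'⟩
  rw [mul_apply, Fintype.sum_prod_type]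
  simp only [conjTranspose_apply, blockDFT, of_apply]
  have h1 : ∀ x : Fin n, ∑ i : ZMod N,
      star (if x = a then ((√N)⁻¹ : ℂ) * ZMod.stdAddChar (i * l) else 0) *
        (if x = b then ((√N)⁻¹ : ℂ) * ZMod.stdAddChar (i * l') else 0) =
      if x = a then (if x = b then (N : ℂ)⁻¹ * ∑ i : ZMod N, ZMod.stdAddChar (i * (l' - l)) else 0)
        else 0 := by
    intro x
    by_cases hxa : x = a
    · by_cases hxb : x = b
      · simp only [if_pos hxa, if_pos hxb, Finset.mul_sum]
        refine Finset.sum_congr rfl fun i _ => ?_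
        rw [← hN, mul_inv, mul_sub, sub_eq_add_neg, AddChar.map_add_eq_mul,
          AddChar.map_neg_eq_conj, star_mul', star_inv₀]
        simp only [Complex.star_def, Complex.conj_ofReal]
        ring
      · simp [hxb]
    · simp [hxa]
  rw [Finset.sum_congr rfl fun x _ => h1 x, Finset.sum_ite_eq' Finset.univ a,
    if_pos (Finset.mem_univ a), AddChar.sum_mulShift _ (ZMod.isPrimitive_stdAddChar N), ZMod.card]
  by_cases hab : a = b
  · by_cases hl : l = l'
    · subst hab hl
      simp [hN0]
    · rw [if_pos hab, if_neg (sub_ne_zero.2 (Ne.symm hl)), Nat.cast_zero, mul_zero,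
        one_apply_ne fun h => hl (Prod.ext_iff.1 h).2]
  · rw [if_neg hab, one_apply_ne fun h => hab (Prod.ext_iff.1 h).1]

lemma blockCirculant_mul_blockDFT {d : ℕ} (hd : d ≤ N) {c : ℕ → Matrix (Fin n) (Fin n) ℂ}
    (hc : ∀ k, d ≤ k → c k = 0) :
    blockCirculant N c * blockDFT N n =
      blockDFT N n * blockDiagonal fun l : ZMod N => matrixPoly d c (ZMod.stdAddChar l) := by
  ext ⟨a, i⟩ ⟨b, l⟩
  rw [mul_apply, mul_apply, Fintype.sum_prod_type, Fintype.sum_prod_type]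
  simp only [blockCirculant, blockDFT, of_apply, blockDiagonal_apply]
  have h1 : ∀ x : Fin n, ∑ j : ZMod N, c (j - i).val a x *
      (if x = b then ((√N)⁻¹ : ℂ) * ZMod.stdAddChar (j * l) else 0) =
      if x = b then ∑ j : ZMod N, c (j - i).val a x * (((√N)⁻¹ : ℂ) * ZMod.stdAddChar (j * l))
        else 0 := by
    intro x
    split_ifs <;> simp
  have h2 : ∀ x : Fin n, ∑ j : ZMod N,
      (if a = x then ((√N)⁻¹ : ℂ) * ZMod.stdAddChar (i * j) else 0) *
        (if j = l then matrixPoly d c (ZMod.stdAddChar j) x b else 0) =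
      if a = x then ((√N)⁻¹ : ℂ) * ZMod.stdAddChar (i * l) *
        matrixPoly d c (ZMod.stdAddChar l) x b else 0 := by
    intro x
    simp only [mul_ite, mul_zero, Finset.sum_ite_eq', Finset.mem_univ, if_true, ite_mul, zero_mul]
  rw [Finset.sum_congr rfl fun x _ => h1 x, Finset.sum_congr rfl fun x _ => h2 x,
    Finset.sum_ite_eq' Finset.univ b, if_pos (Finset.mem_univ b), Finset.sum_ite_eq Finset.univ a,
    if_pos (Finset.mem_univ a), ← Equiv.sum_comp (Equiv.addRight i)]
  simp only [Equiv.coe_addRight, add_sub_cancel_right, add_mul, AddChar.map_add_eq_mul]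
  rw [matrixPoly, Matrix.sum_apply, Finset.mul_sum]
  have h3 : ∀ k, d ≤ k → ((√N)⁻¹ : ℂ) * ZMod.stdAddChar (i * l) *
      ((ZMod.stdAddChar l ^ k • c k) a b) = 0 := by
    intro k hk
    simp [hc k hk]
  rw [Finset.sum_subset (Finset.range_mono hd) fun k _ hk => h3 k (by simpa using hk)]
  refine Finset.sum_bij' (fun k _ => k.val) (fun k _ => (k : ZMod N))
    (fun k _ => Finset.mem_range.2 k.val_lt) (by simp) (fun k _ => ZMod.natCast_zmod_val k)
    (fun k hk => ZMod.val_cast_of_lt (Finset.mem_range.1 hk)) fun k _ => ?_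
  have h4 : (ZMod.stdAddChar (k * l) : ℂ) = ZMod.stdAddChar l ^ k.val := by
    rw [← AddChar.map_nsmul_eq_pow, nsmul_eq_mul, ZMod.natCast_zmod_val]
  rw [h4, Matrix.smul_apply, smul_eq_mul]
  ring

lemma schattenPow_blockCirculant (p : ℝ) {d : ℕ} (hd : d ≤ N)
    {c : ℕ → Matrix (Fin n) (Fin n) ℂ} (hc : ∀ k, d ≤ k → c k = 0) :
    schattenPow p (blockCirculant N c) =
      ∑ l : ZMod N, schattenPow p (matrixPoly d c (ZMod.stdAddChar l)) := by
  have h := blockDFT_conjTranspose_mul N n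
  rw [← schattenPow_blockDiagonal, ← schattenPow_unitary_mul p h (blockDiagonal _),
    ← blockCirculant_mul_blockDFT N hd hc, schattenPow_mul_unitary p (mul_eq_one_comm.1 h)]

lemma blockTriangular_blockToeplitz (c : ℕ → Matrix (Fin n) (Fin n) ℂ) :
    BlockTriangular (blockToeplitz N c) fun x => x.2.val := by
  intro x y hxy
  exact if_neg (not_le.2 hxy)

lemma blockPart_blockToeplitz (c : ℕ → Matrix (Fin n) (Fin n) ℂ) :
    blockPart (fun x : Fin n × ZMod N => x.2.val) (blockToeplitz N c) =
      blockDiagonal fun _ => c 0 := by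
  ext ⟨a, i⟩ ⟨b, j⟩
  simp only [blockPart, blockToeplitz, of_apply, blockDiagonal_apply]
  by_cases h : i = j
  · simp [h]
  · rw [if_neg h, if_neg fun h' => h (ZMod.val_injective N h')]

lemma blockToeplitz_sub_blockPart (c : ℕ → Matrix (Fin n) (Fin n) ℂ) :
    blockToeplitz N c - blockPart (fun x : Fin n × ZMod N => x.2.val) (blockToeplitz N c) =
      blockToeplitz N (Function.update c 0 0) := by
  ext ⟨a, i⟩ ⟨b, j⟩
  simp only [blockPart, blockToeplitz, of_apply, Matrix.sub_apply]
  rcases lt_trichotomy i.val j.val with h | h | h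
  · rw [if_pos h.le, if_neg h.ne, if_pos h.le, Function.update_of_ne (by lia), sub_zero]
  · simp [h]
  · rw [if_neg (not_le.2 h), if_neg h.ne', if_neg (not_le.2 h), sub_zero]

/-- Truncated Toeplitz matrices differ from circulant ones by a matrix of bounded size. -/
lemma schattenPow_blockCirculant_sub_le {p : ℝ} (hp0 : 0 < p) (hp2 : p ≤ 2) {d : ℕ} (hd : d ≤ N)
    {c : ℕ → Matrix (Fin n) (Fin n) ℂ} (hc : ∀ k, d ≤ k → c k = 0) :
    schattenPow p (blockToeplitz N c - blockCirculant N c) ≤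
      (∑ a, ∑ b, ∑ _j ∈ Finset.range d, ∑ k ∈ Finset.range d, Complex.normSq (c k a b)) ^ (p / 2) *
        ((n * d : ℕ) : ℝ) ^ (1 - p / 2) := by
  set R := blockToeplitz N c - blockCirculant N c with hR
  have hR0 : ∀ x y : Fin n × ZMod N, d ≤ y.2.val → R x y = 0 := by
    rintro ⟨a, i⟩ ⟨b, j⟩ hj
    simp only [hR, blockToeplitz, blockCirculant, of_apply, Matrix.sub_apply] at hj ⊢
    split_ifs with h
    · rw [ZMod.val_sub h, sub_self]
    · rw [not_le] at h
      have h1 : (j - i).val = N - (i.val - j.val) := by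
        rw [← neg_sub i j, ZMod.neg_val, if_neg, ZMod.val_sub h.le]
        exact sub_ne_zero.2 fun h' => h.ne (by rw [h'])
      rw [hc _ (by have := i.val_lt; lia), Matrix.zero_apply, sub_self]
  have hRle : ∀ x y : Fin n × ZMod N,
      Complex.normSq (R x y) ≤ Complex.normSq (c (y.2 - x.2).val x.1 y.1) := by
    rintro ⟨a, i⟩ ⟨b, j⟩
    simp only [hR, blockToeplitz, blockCirculant, of_apply, Matrix.sub_apply]
    split_ifs with h
    · rw [ZMod.val_sub h, sub_self, map_zero]
      exact Complex.normSq_nonneg _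
    · rw [zero_sub, Complex.normSq_neg]
  set J : Finset (Fin n × ZMod N) :=
    Finset.univ ×ˢ (Finset.range d).image (fun k : ℕ => (k : ZMod N)) with hJ
  have hmem : ∀ y : Fin n × ZMod N, y.2.val < d → y ∈ J := by
    intro y hy
    rw [hJ, Finset.mem_product, Finset.mem_image]
    exact ⟨Finset.mem_univ _, y.2.val, Finset.mem_range.2 hy, ZMod.natCast_zmod_val _⟩
  have hcard : J.card ≤ n * d := by
    rw [hJ, Finset.card_product, Finset.card_univ, Fintype.card_fin]
    exact Nat.mul_le_mul_left n (Finset.card_image_le.trans (Finset.card_range d).le)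
  have hsum : ∀ f : ℕ → ℝ, (∀ k, d ≤ k → f k = 0) →
      ∑ k : ZMod N, f k.val = ∑ k ∈ Finset.range d, f k := by
    intro f hf
    rw [Finset.sum_subset (Finset.range_mono hd) fun k _ hk => hf k (by simpa using hk)]
    exact Finset.sum_bij' (fun k _ => k.val) (fun k _ => (k : ZMod N))
      (fun k _ => Finset.mem_range.2 k.val_lt) (by simp) (fun k _ => ZMod.natCast_zmod_val k)
      (fun k hk => ZMod.val_cast_of_lt (Finset.mem_range.1 hk)) fun k _ => rfl
  have hS2 : schattenPow 2 R ≤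
      ∑ a, ∑ b, ∑ _j ∈ Finset.range d, ∑ k ∈ Finset.range d, Complex.normSq (c k a b) := by
    rw [schattenPow_two, Fintype.sum_prod_type]
    refine Finset.sum_le_sum fun a _ => ?_
    rw [Finset.sum_comm, Fintype.sum_prod_type]
    refine Finset.sum_le_sum fun b _ => ?_
    have hc' : ∀ k, d ≤ k → Complex.normSq (c k a b) = 0 := fun k hk => by simp [hc k hk]
    calc ∑ j : ZMod N, ∑ i : ZMod N, Complex.normSq (R (a, i) (b, j))
        ≤ ∑ j : ZMod N, if j.val < d then
            ∑ k ∈ Finset.range d, Complex.normSq (c k a b) else 0 := by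
          refine Finset.sum_le_sum fun j _ => ?_
          split_ifs with hj
          · refine (Finset.sum_le_sum fun i _ => hRle (a, i) (b, j)).trans (le_of_eq ?_)
            rw [← hsum _ hc']
            exact Equiv.sum_comp (Equiv.subLeft j) fun k : ZMod N => Complex.normSq (c k.val a b)
          · exact (Finset.sum_eq_zero fun i _ => by
              rw [hR0 (a, i) (b, j) (not_lt.1 hj), map_zero]).le
      _ = ∑ _j ∈ Finset.range d, ∑ k ∈ Finset.range d, Complex.normSq (c k a b) := by
          rw [hsum (fun j => if j < d then
            ∑ k ∈ Finset.range d, Complex.normSq (c k a b) else 0) fun k hk => if_neg (not_lt.2 hk)]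
          exact Finset.sum_congr rfl fun j hj => if_pos (Finset.mem_range.1 hj)
  refine (schattenPow_le_card hp0 hp2 R J fun y hy x => hR0 x y ?_).trans ?_
  · by_contra h
    exact hy (hmem y (not_le.1 h))
  · refine mul_le_mul (Real.rpow_le_rpow (schattenPow_nonneg _ _) hS2 (by linarith))
      (Real.rpow_le_rpow (Nat.cast_nonneg _) (by exact_mod_cast hcard) (by linarith))
      (Real.rpow_nonneg (Nat.cast_nonneg _) _)
      (Real.rpow_nonneg ((schattenPow_nonneg _ _).trans hS2) _)

end Toeplitz

section ToeplitzLimit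

variable {n : ℕ}

lemma tendsto_schattenPow_blockToeplitz {p : ℝ} (hp0 : 0 < p) (hp2 : p ≤ 2) {d : ℕ}
    {c : ℕ → Matrix (Fin n) (Fin n) ℂ} (hc : ∀ k, d ≤ k → c k = 0) :
    Filter.Tendsto (fun N : ℕ => schattenPow p (blockToeplitz (N + 1) c) / (N + 1)) Filter.atTop
      (nhds (circleMean fun z => schattenPow p (matrixPoly d c z))) := by
  have hC := tendsto_sum_stdAddChar ((continuous_schattenPow hp0 hp2).comp
    (continuous_matrixPoly d c))
  set L := circleMean fun z => schattenPow p (matrixPoly d c z) with hL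
  set K := (∑ a, ∑ b, ∑ _j ∈ Finset.range d, ∑ k ∈ Finset.range d, Complex.normSq (c k a b)) ^
    (p / 2) * ((n * d : ℕ) : ℝ) ^ (1 - p / 2) with hK
  have hsq : Filter.Tendsto (fun N : ℕ => √(schattenPow p (blockToeplitz (N + 1) c) / (N + 1)))
      Filter.atTop (nhds (√L)) := by
    have h1 : Filter.Tendsto (fun N : ℕ => √(schattenPow p (blockCirculant (N + 1) c) / (N + 1)))
        Filter.atTop (nhds (√L)) := by
      refine (Real.continuous_sqrt.tendsto L).comp (hC.congr' ?_)
      filter_upwards [Filter.eventually_ge_atTop d] with N hN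
      rw [schattenPow_blockCirculant (N + 1) p (hN.trans (Nat.le_succ N)) hc]
      rfl
    have h2 : Filter.Tendsto (fun N : ℕ => √(K / ((N : ℝ) + 1))) Filter.atTop (nhds 0) := by
      have h3 : Filter.Tendsto (fun N : ℕ => K * (1 / ((N : ℝ) + 1))) Filter.atTop (nhds (K * 0)) :=
        tendsto_one_div_add_atTop_nhds_zero_nat.const_mul K
      have h4 := (Real.continuous_sqrt.tendsto _).comp h3
      rw [mul_zero, Real.sqrt_zero] at h4
      refine h4.congr fun N => ?_
      rw [Function.comp_apply, mul_one_div]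
    have h5 : Filter.Tendsto (fun N : ℕ => √(schattenPow p (blockToeplitz (N + 1) c) / (N + 1)) -
        √(schattenPow p (blockCirculant (N + 1) c) / (N + 1))) Filter.atTop (nhds 0) := by
      refine squeeze_zero_norm' ?_ h2
      filter_upwards [Filter.eventually_ge_atTop d] with N hN
      have hN0 : (0 : ℝ) ≤ N + 1 := by positivity
      rw [Real.sqrt_div' _ hN0, Real.sqrt_div' _ hN0, Real.sqrt_div' _ hN0, ← sub_div, norm_div,
        Real.norm_of_nonneg (Real.sqrt_nonneg ((N : ℝ) + 1))]
      refine div_le_div_of_nonneg_right ?_ (Real.sqrt_nonneg _)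
      exact (abs_sqrt_schattenPow_sub_le hp0 hp2 _ _).trans (Real.sqrt_le_sqrt
        (schattenPow_blockCirculant_sub_le (N + 1) hp0 hp2 (hN.trans (Nat.le_succ N)) hc))
    have := h5.add h1
    simpa only [sub_add_cancel, zero_add] using this
  have hL0 : 0 ≤ L := by
    refine mul_nonneg (by positivity) (intervalIntegral.integral_nonneg (by positivity) ?_)
    exact fun t _ => schattenPow_nonneg _ _
  have := hsq.pow 2
  rw [Real.sq_sqrt hL0] at this
  refine this.congr fun N => ?_
  rw [Real.sq_sqrt]
  exact div_nonneg (schattenPow_nonneg _ _) (by positivity)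

/-- Uniform convexity inequality for analytic matrix polynomials. -/
lemma TriangularConvexity.apply_matrixPoly {p δ : ℝ} (h : TriangularConvexity p δ) (hp0 : 0 < p)
    (hp2 : p ≤ 2) {d : ℕ} {c : ℕ → Matrix (Fin n) (Fin n) ℂ} (hc : ∀ k, d ≤ k → c k = 0) :
    schattenPow p (c 0) ^ (2 / p) +
        δ * circleMean (fun z => schattenPow p (matrixPoly d c z - c 0)) ^ (2 / p) ≤
      circleMean (fun z => schattenPow p (matrixPoly d c z)) ^ (2 / p) := by
  have hq : 0 < 2 / p := by positivity
  have hc' : ∀ k, d ≤ k → Function.update c 0 0 k = 0 := by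
    intro k hk
    rcases eq_or_ne k 0 with rfl | h0
    · simp
    · rw [Function.update_of_ne h0, hc k hk]
  have hpoly : ∀ z, matrixPoly d c z - c 0 =
      matrixPoly d (Function.update c 0 0) z := by
    intro z
    rcases d with - | d
    · simp [matrixPoly, hc 0 le_rfl]
    · simp [matrixPoly, Finset.sum_range_succ']
  simp only [hpoly]
  have h1 := tendsto_schattenPow_blockToeplitz hp0 hp2 hc
  have h2 := tendsto_schattenPow_blockToeplitz hp0 hp2 hc'
  have h3 := (h2.rpow_const (p := 2 / p) (Or.inr hq.le)).const_mul δ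
  refine le_of_tendsto_of_tendsto' (h3.const_add _) (h1.rpow_const (Or.inr hq.le)) fun N => ?_
  have hN : (0 : ℝ) < N + 1 := by positivity
  have h4 := h.apply (fun x : Fin n × ZMod (N + 1) => x.2.val)
    (blockTriangular_blockToeplitz (N + 1) c)
  rw [blockToeplitz_sub_blockPart, blockPart_blockToeplitz, schattenPow_blockDiagonal,
    Finset.sum_const, Finset.card_univ, ZMod.card, nsmul_eq_mul,
    Real.mul_rpow (by positivity) (schattenPow_nonneg _ _)] at h4
  push_cast at h4
  rw [Real.div_rpow (schattenPow_nonneg _ _) hN.le, Real.div_rpow (schattenPow_nonneg _ _) hN.le,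
    le_div_iff₀ (by positivity), add_mul, mul_assoc δ, div_mul_cancel₀ _ (by positivity), mul_comm]
  exact h4

end ToeplitzLimit

section Approximation

lemma tendsto_circleMean {ι : Type*} {l : Filter ι} [l.IsCountablyGenerated] {g : ι → ℂ → ℝ}
    {g₀ : ℂ → ℝ} {M : ℝ} (hcont : ∀ᶠ i in l, ContinuousOn (g i) (Metric.sphere 0 1))
    (hbound : ∀ᶠ i in l, ∀ z ∈ Metric.sphere (0 : ℂ) 1, |g i z| ≤ M)
    (hlim : ∀ z ∈ Metric.sphere (0 : ℂ) 1, Filter.Tendsto (fun i => g i z) l (nhds (g₀ z))) :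
    Filter.Tendsto (fun i => circleMean (g i)) l (nhds (circleMean g₀)) := by
  have hmem : ∀ t : ℝ, Complex.exp (Complex.I * t) ∈ Metric.sphere (0 : ℂ) 1 := fun t => by
    rw [mem_sphere_zero_iff_norm, mul_comm, Complex.norm_exp_ofReal_mul_I]
  refine Filter.Tendsto.const_mul _
    (intervalIntegral.tendsto_integral_filter_of_dominated_convergence (fun _ => M) ?_ ?_ ?_ ?_)
  · filter_upwards [hcont] with i hi
    exact (hi.comp_continuous (by fun_prop) hmem).aestronglyMeasurable
  · filter_upwards [hbound] with i hi
    exact Filter.Eventually.of_forall fun t _ => hi _ (hmem t)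
  · exact intervalIntegrable_const
  · exact Filter.Eventually.of_forall fun t _ => hlim _ (hmem t)

variable {n : ℕ}

lemma exists_schattenPow_le {p : ℝ} (hp0 : 0 < p) (hp2 : p ≤ 2) (n : ℕ) (M : ℝ) :
    ∃ K, ∀ A : Matrix (Fin n) (Fin n) ℂ, ‖A‖ ≤ M → schattenPow p A ≤ K := by
  have : ProperSpace (Matrix (Fin n) (Fin n) ℂ) := FiniteDimensional.proper ℂ _
  obtain ⟨K, hK⟩ := (isCompact_closedBall (0 : Matrix (Fin n) (Fin n) ℂ) M).bddAbove_image
    (continuous_schattenPow hp0 hp2).continuousOn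
  exact ⟨K, fun A hA => hK ⟨A, mem_closedBall_zero_iff.2 hA, rfl⟩⟩

lemma tendsto_circleMean_schattenPow {p : ℝ} (hp0 : 0 < p) (hp2 : p ≤ 2) {ι : Type*}
    {l : Filter ι} [l.IsCountablyGenerated] {G : ι → ℂ → Matrix (Fin n) (Fin n) ℂ}
    {F : ℂ → Matrix (Fin n) (Fin n) ℂ} {M : ℝ}
    (hcont : ∀ᶠ i in l, ContinuousOn (G i) (Metric.sphere 0 1))
    (hbound : ∀ᶠ i in l, ∀ z ∈ Metric.sphere (0 : ℂ) 1, ‖G i z‖ ≤ M)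
    (hlim : ∀ z ∈ Metric.sphere (0 : ℂ) 1, Filter.Tendsto (fun i => G i z) l (nhds (F z))) :
    Filter.Tendsto (fun i => circleMean fun z => schattenPow p (G i z)) l
      (nhds (circleMean fun z => schattenPow p (F z))) := by
  have hS := continuous_schattenPow (ι := Fin n) hp0 hp2
  obtain ⟨K, hK⟩ := exists_schattenPow_le hp0 hp2 n M
  refine tendsto_circleMean (M := K) ?_ ?_ fun z hz => (hS.tendsto _).comp (hlim z hz)
  · filter_upwards [hcont] with i hi
    exact hS.comp_continuousOn hi
  · filter_upwards [hbound] with i hi z hz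
    rw [abs_of_nonneg (schattenPow_nonneg _ _)]
    exact hK _ (hi z hz)

/-- The uniform convexity inequality for a function on the circle with mean value `A`. -/
def CircleConvexity (p δ : ℝ) (A : Matrix (Fin n) (Fin n) ℂ) (F : ℂ → Matrix (Fin n) (Fin n) ℂ) :
    Prop :=
  schattenPow p A ^ (2 / p) + δ * circleMean (fun z => schattenPow p (F z - A)) ^ (2 / p) ≤
    circleMean (fun z => schattenPow p (F z)) ^ (2 / p)

lemma CircleConvexity.of_tendsto {p δ : ℝ} (hp0 : 0 < p) (hp2 : p ≤ 2) {ι : Type*}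
    {l : Filter ι} [l.IsCountablyGenerated] [l.NeBot] {G : ι → ℂ → Matrix (Fin n) (Fin n) ℂ}
    {F : ℂ → Matrix (Fin n) (Fin n) ℂ} {A : Matrix (Fin n) (Fin n) ℂ} {M : ℝ}
    (hG : ∀ᶠ i in l, CircleConvexity p δ A (G i))
    (hcont : ∀ᶠ i in l, ContinuousOn (G i) (Metric.sphere 0 1))
    (hbound : ∀ᶠ i in l, ∀ z ∈ Metric.sphere (0 : ℂ) 1, ‖G i z‖ ≤ M)
    (hlim : ∀ z ∈ Metric.sphere (0 : ℂ) 1, Filter.Tendsto (fun i => G i z) l (nhds (F z))) :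
    CircleConvexity p δ A F := by
  have hq : 0 ≤ 2 / p := by positivity
  have h1 := tendsto_circleMean_schattenPow hp0 hp2 hcont hbound hlim
  have h2 := tendsto_circleMean_schattenPow (G := fun i z => G i z - A) (F := fun z => F z - A)
    (M := M + ‖A‖) hp0 hp2 (hcont.mono fun i hi => hi.sub continuousOn_const)
    (hbound.mono fun i hi z hz => (norm_sub_le _ _).trans (by gcongr; exact hi z hz))
    fun z hz => (hlim z hz).sub_const A
  exact le_of_tendsto_of_tendsto
    (((h2.rpow_const (p := 2 / p) (Or.inr hq)).const_mul δ).const_add _)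
    (h1.rpow_const (Or.inr hq)) hG

lemma TriangularConvexity.circleConvexity_comp_mul {p δ : ℝ} (h : TriangularConvexity p δ)
    (hp0 : 0 < p) (hp2 : p ≤ 2) {F : ℂ → Matrix (Fin n) (Fin n) ℂ}
    (hF : ContinuousOn F (Metric.closedBall 0 1)) (hF' : DifferentiableOn ℂ F (Metric.ball 0 1))
    {r : ℝ} (hr0 : 0 < r) (hr1 : r < 1) : CircleConvexity p δ (F 0) fun z => F (r * z) := by
  have : CompleteSpace (Matrix (Fin n) (Fin n) ℂ) := FiniteDimensional.complete ℂ _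
  obtain ⟨s, hrs, hs1⟩ := exists_between hr1
  have hs0 := hr0.trans hrs
  lift s to NNReal using hs0.le
  have hs1' : s < 1 := by exact_mod_cast hs1
  have hsub : Metric.closedBall (0 : ℂ) s ⊆ Metric.ball 0 1 :=
    Metric.closedBall_subset_ball hs1
  set P := cauchyPowerSeries F 0 s with hP
  have hps : HasFPowerSeriesOnBall F P 0 s :=
    (hF'.mono hsub).hasFPowerSeriesOnBall (by exact_mod_cast hs0)
  obtain ⟨q, hrq, hqs⟩ := exists_between hrs
  have hq0 := hr0.trans hrq
  lift q to NNReal using hq0.le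
  have hunif := hps.tendstoUniformlyOn (r' := q) (by exact_mod_cast hqs)
  simp only [zero_add] at hunif
  have hz : ∀ z ∈ Metric.sphere (0 : ℂ) 1, (r : ℂ) * z ∈ Metric.ball (0 : ℂ) q := by
    intro z hz
    rw [mem_ball_zero_iff, norm_mul, mem_sphere_zero_iff_norm.1 hz, mul_one, Complex.norm_real,
      Real.norm_of_nonneg hr0.le]
    exact hrq
  obtain ⟨M, hM⟩ := (isCompact_closedBall (0 : ℂ) 1).exists_bound_of_continuousOn hF
  have hpoly : ∀ d z, P.partialSum (d + 1) ((r : ℂ) * z) =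
      matrixPoly (d + 1) (fun k => if k < d + 1 then (r : ℂ) ^ k • P.coeff k else 0) z := by
    intro d z
    rw [matrixPoly, FormalMultilinearSeries.partialSum]
    refine Finset.sum_congr rfl fun k hk => ?_
    rw [if_pos (Finset.mem_range.1 hk), FormalMultilinearSeries.apply_eq_pow_smul_coeff, mul_pow,
      smul_smul, mul_comm]
  refine CircleConvexity.of_tendsto (l := Filter.atTop) (M := M + 1)
    (G := fun d z => P.partialSum (d + 1) (r * z)) hp0 hp2 ?_ ?_ ?_ ?_
  · refine Filter.Eventually.of_forall fun d => ?_
    obtain ⟨c, hc⟩ : ∃ c : ℕ → Matrix (Fin n) (Fin n) ℂ,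
      c = fun k => if k < d + 1 then (r : ℂ) ^ k • P.coeff k else 0 := ⟨_, rfl⟩
    have h0 : c 0 = F 0 := by
      have h1 : P.coeff 0 = F 0 := hps.coeff_zero _
      simp [hc, h1]
    have h2 : (fun z => P.partialSum (d + 1) ((r : ℂ) * z)) = matrixPoly (d + 1) c := by
      rw [hc]
      exact funext (hpoly d)
    have h3 : CircleConvexity p δ (c 0) (matrixPoly (d + 1) c) :=
      h.apply_matrixPoly hp0 hp2 fun k hk => by rw [hc]; exact if_neg (not_lt.2 hk)
    rwa [h0, ← h2] at h3
  · refine Filter.Eventually.of_forall fun d => Continuous.continuousOn ?_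
    simp only [hpoly]
    exact continuous_matrixPoly _ _
  · have h1 := (Filter.tendsto_add_atTop_nat 1).eventually
      (Metric.tendstoUniformlyOn_iff.1 hunif 1 one_pos)
    filter_upwards [h1] with d hd z hz'
    have h2 := hd _ (hz z hz')
    rw [dist_eq_norm] at h2
    have h3 : ‖F (r * z)‖ ≤ M := hM _ (Metric.ball_subset_closedBall
      (Metric.ball_subset_ball (hqs.trans hs1).le (hz z hz')))
    have h4 := norm_sub_norm_le (P.partialSum (d + 1) (r * z)) (F (r * z))
    rw [norm_sub_rev] at h4
    linarith
  · intro z hz'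
    exact (hunif.tendsto_at (hz z hz')).comp (Filter.tendsto_add_atTop_nat 1)

lemma TriangularConvexity.circleConvexity {p δ : ℝ} (h : TriangularConvexity p δ)
    (hp0 : 0 < p) (hp2 : p ≤ 2) {F : ℂ → Matrix (Fin n) (Fin n) ℂ}
    (hF : ContinuousOn F (Metric.closedBall 0 1)) (hF' : DifferentiableOn ℂ F (Metric.ball 0 1)) :
    CircleConvexity p δ (F 0) F := by
  obtain ⟨M, hM⟩ := (isCompact_closedBall (0 : ℂ) 1).exists_bound_of_continuousOn hF
  have hIoo : Set.Ioo (0 : ℝ) 1 ∈ nhdsWithin 1 (Set.Iio 1) := Ioo_mem_nhdsLT one_pos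
  have hz : ∀ r ∈ Set.Ioo (0 : ℝ) 1, ∀ z ∈ Metric.sphere (0 : ℂ) 1,
      (r : ℂ) * z ∈ Metric.closedBall (0 : ℂ) 1 := by
    intro r hr z hz
    rw [mem_closedBall_zero_iff, norm_mul, mem_sphere_zero_iff_norm.1 hz, mul_one,
      Complex.norm_real, Real.norm_of_nonneg hr.1.le]
    exact hr.2.le
  refine CircleConvexity.of_tendsto (l := nhdsWithin (1 : ℝ) (Set.Iio 1)) (M := M)
    (G := fun r z => F (r * z)) hp0 hp2 ?_ ?_ ?_ ?_
  · filter_upwards [hIoo] with r hr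
    exact h.circleConvexity_comp_mul hp0 hp2 hF hF' hr.1 hr.2
  · filter_upwards [hIoo] with r hr
    exact hF.comp (by fun_prop) (hz r hr)
  · filter_upwards [hIoo] with r hr z hz'
    exact hM _ (hz r hr z hz')
  · intro z hz'
    refine (hF z (Metric.sphere_subset_closedBall hz')).tendsto.comp
      (tendsto_nhdsWithin_iff.2 ⟨?_, ?_⟩)
    · have h1 : Continuous fun r : ℝ => (r : ℂ) * z := by fun_prop
      have h2 := (h1.tendsto 1).mono_left (nhdsWithin_le_nhds (s := Set.Iio 1))
      simpa using h2
    · filter_upwards [hIoo] with r hr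
      exact hz r hr z hz'

end Approximation

/-- Q. Xu's uniform convexity inequality for `H_p`, `0 < p ≤ 2`, matrix version. -/
theorem statement11 (p : ℝ) (hp0 : 0 < p) (hp2 : p ≤ 2) :
    ∃ δ : ℝ, 0 < δ ∧ ∀ (n : ℕ) (F : ℂ → Matrix (Fin n) (Fin n) ℂ),
      ContinuousOn F (Metric.closedBall 0 1) →
      DifferentiableOn ℂ F (Metric.ball 0 1) →
      schattenNorm p (F 0) ^ 2 +
          δ * ((1 / (2 * Real.pi)) * ∫ t in (0:ℝ)..(2 * Real.pi),
                schattenNorm p (F (Complex.exp (Complex.I * t)) - F 0) ^ p) ^ (2 / p) ≤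
        ((1 / (2 * Real.pi)) * ∫ t in (0:ℝ)..(2 * Real.pi),
            schattenNorm p (F (Complex.exp (Complex.I * t))) ^ p) ^ (2 / p) := by
  obtain ⟨δ, hδ, -, h⟩ := exists_triangularConvexity hp0 hp2
  refine ⟨δ, hδ, fun n F hF hF' => ?_⟩
  simp only [schattenNorm_sq, schattenNorm_rpow hp0]
  exact h.circleConvexity hp0 hp2 hF hF'
end

section
/- (Lemma 4.2, matrix version.) Let 0<p<1 and α = 1/p − 1/2. Let f, f₀ ∈ M_n(ℂ) be positive semidefinite with Tr f = Tr f₀ = 1, with f₀ positive definite, and set g = (f^{2α} + f₀^{2α})^{1/(2α)} (powers by the spectral functional calculus). Then g is positive definite, Tr g ≤ 2, and for every y ∈ M_n(ℂ) there exists y′ ∈ M_n(ℂ) with (f^{α} y + y f^{α})/2 = (g^{α} y′ + y′ g^{α})/2 and ‖y′‖_2 ≤ 2‖y‖_2; equivalently ‖J(g^{α})^{-1}(J(f^{α})(y))‖_2 ≤ 2‖y‖_2. -/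
open scoped BigOperators
open Matrix MeasureTheory
open scoped ComplexOrder

namespace Matrix

variable {ι : Type*} [Fintype ι] [DecidableEq ι] {A B X P : Matrix ι ι ℂ}

section PosPow

theorem posPow_eq_cfc (hA : A.IsHermitian) (s : ℝ) :
    posPow A s = _root_.cfc (fun t : ℝ => t ^ s) A := by
  rw [posPow, dif_pos hA, hA.cfc_eq]

theorem continuousOn_real_spectrum (A : Matrix ι ι ℂ) (φ : ℝ → ℝ) :
    ContinuousOn φ (spectrum ℝ A) :=
  A.finite_real_spectrum.continuousOn φ

theorem PosSemidef.nonneg_of_mem_spectrum (hA : A.PosSemidef) {x : ℝ} (hx : x ∈ spectrum ℝ A) :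
    0 ≤ x := by
  rw [hA.1.spectrum_real_eq_range_eigenvalues] at hx
  obtain ⟨i, rfl⟩ := hx
  exact hA.eigenvalues_nonneg i

theorem PosDef.pos_of_mem_spectrum (hA : A.PosDef) {x : ℝ} (hx : x ∈ spectrum ℝ A) :
    0 < x := by
  rw [hA.1.spectrum_real_eq_range_eigenvalues] at hx
  obtain ⟨i, rfl⟩ := hx
  exact hA.eigenvalues_pos i

theorem isHermitian_posPow (hA : A.IsHermitian) (s : ℝ) : (posPow A s).IsHermitian := by
  rw [posPow_eq_cfc hA]
  exact cfc_predicate _ A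

theorem posPow_one (hA : A.IsHermitian) : posPow A 1 = A := by
  rw [posPow_eq_cfc hA]
  simpa using cfc_id' ℝ A hA.isSelfAdjoint

theorem posPow_add (hA : A.PosSemidef) {s t : ℝ} (hs : 0 ≤ s) (ht : 0 ≤ t) :
    posPow A (s + t) = posPow A s * posPow A t := by
  simp only [posPow_eq_cfc hA.1]
  rw [← cfc_mul _ _ A (continuousOn_real_spectrum _ _) (continuousOn_real_spectrum _ _)]
  exact cfc_congr fun x hx => Real.rpow_add_of_nonneg (hA.nonneg_of_mem_spectrum hx) hs ht

theorem posPow_half_mul_self (hA : A.PosSemidef) : posPow A (1 / 2) * posPow A (1 / 2) = A := by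
  rw [← posPow_add hA (by norm_num) (by norm_num), add_halves, posPow_one hA.1]

theorem PosDef.posPow_add (hA : A.PosDef) (s t : ℝ) :
    posPow A (s + t) = posPow A s * posPow A t := by
  simp only [posPow_eq_cfc hA.1]
  rw [← cfc_mul _ _ A (continuousOn_real_spectrum _ _) (continuousOn_real_spectrum _ _)]
  exact cfc_congr fun x hx => Real.rpow_add (hA.pos_of_mem_spectrum hx) s t

theorem posPow_zero (hA : A.IsHermitian) : posPow A 0 = 1 := by
  rw [posPow_eq_cfc hA]
  simpa using cfc_const_one ℝ A hA.isSelfAdjoint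

theorem posPow_posPow (hA : A.PosSemidef) (s t : ℝ) :
    posPow (posPow A s) t = posPow A (s * t) := by
  rw [posPow_eq_cfc (isHermitian_posPow hA.1 s), posPow_eq_cfc hA.1, posPow_eq_cfc hA.1,
    ← cfc_comp' (fun x : ℝ => x ^ t) (fun x : ℝ => x ^ s) A
      ((A.finite_real_spectrum.image _).continuousOn _) (continuousOn_real_spectrum _ _)
      hA.1.isSelfAdjoint]
  exact cfc_congr fun x hx => (Real.rpow_mul (hA.nonneg_of_mem_spectrum hx) s t).symm

theorem PosDef.isUnit_posPow (hA : A.PosDef) (s : ℝ) : IsUnit (posPow A s) :=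
  isUnit_iff_exists.2 ⟨posPow A (-s), by rw [← hA.posPow_add, add_neg_cancel, posPow_zero hA.1],
    by rw [← hA.posPow_add, neg_add_cancel, posPow_zero hA.1]⟩

theorem PosSemidef.posPow (hA : A.PosSemidef) (s : ℝ) : (posPow A s).PosSemidef := by
  have h : _root_.posPow A s = (_root_.posPow (_root_.posPow A s) (1 / 2))ᴴ *
      _root_.posPow (_root_.posPow A s) (1 / 2) := by
    rw [(isHermitian_posPow (isHermitian_posPow hA.1 s) _).eq, posPow_posPow hA,
      posPow_eq_cfc hA.1, posPow_eq_cfc hA.1,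
      ← cfc_mul _ _ A (continuousOn_real_spectrum _ _) (continuousOn_real_spectrum _ _)]
    refine cfc_congr fun x hx => ?_
    have hx := hA.nonneg_of_mem_spectrum hx
    rw [Real.rpow_mul hx, ← Real.sqrt_eq_rpow]
    exact (Real.mul_self_sqrt (Real.rpow_nonneg hx s)).symm
  rw [h]
  exact posSemidef_conjTranspose_mul_self _

theorem PosDef.posPow (hA : A.PosDef) (s : ℝ) : (posPow A s).PosDef :=
  (hA.posSemidef.posPow s).posDef_iff_isUnit.2 (hA.isUnit_posPow s)

section
open scoped MatrixOrder Matrix.Norms.L2Operator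

/-- The Löwner–Heinz inequality. -/
theorem posSemidef_posPow_sub_posPow (hA : A.PosSemidef) (hAB : (B - A).PosSemidef) {s : ℝ}
    (hs : s ∈ Set.Icc (0 : ℝ) 1) : (posPow B s - posPow A s).PosSemidef := by
  have hB : B.PosSemidef := by simpa using hAB.add hA
  let _ : CStarAlgebra (Matrix ι ι ℂ) := {}
  have h : A ^ s ≤ B ^ s := CFC.rpow_le_rpow hs hAB
  rw [CFC.rpow_eq_cfc_real hA.nonneg, CFC.rpow_eq_cfc_real hB.nonneg,
    ← posPow_eq_cfc hA.1, ← posPow_eq_cfc hB.1] at h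
  exact h

end

end PosPow

theorem posSemidef_one_sub_conjTranspose_mul_self (hX : (1 - X * Xᴴ).PosSemidef) :
    (1 - Xᴴ * X).PosSemidef := by
  have h1 := posSemidef_conjTranspose_mul_self (1 - Xᴴ * X)
  have h2 := (hX.conjTranspose_mul_mul_same X).add h1
  have h : Xᴴ * (1 - X * Xᴴ) * X + (1 - Xᴴ * X)ᴴ * (1 - Xᴴ * X) = 1 - Xᴴ * X := by
    simp only [conjTranspose_sub, conjTranspose_one, conjTranspose_mul, conjTranspose_conjTranspose]
    noncomm_ring
  rwa [h] at h2

theorem trace_mul_mul_conjTranspose_re_le (hX : (1 - Xᴴ * X).PosSemidef) (hP : P.PosSemidef) :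
    (X * P * Xᴴ).trace.re ≤ P.trace.re := by
  have hQ := (isHermitian_posPow hP.1 (1 / 2)).eq
  have hP2 : posPow P (1 / 2) * posPow P (1 / 2) = P := posPow_half_mul_self hP
  set Q := posPow P (1 / 2)
  have h := (Complex.le_def.1 (hX.conjTranspose_mul_mul_same Q).trace_nonneg).1
  have e : (Qᴴ * (Xᴴ * X) * Q).trace = (X * P * Xᴴ).trace := by
    rw [← hP2, hQ, mul_assoc, trace_mul_comm, trace_mul_comm (X * (Q * Q))]
    simp only [mul_assoc]
  rw [mul_sub, sub_mul, trace_sub, mul_one, e, hQ, hP2, Complex.sub_re, Complex.zero_re] at h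
  linarith

/-- If `0 ≤ A ≤ B` and `B` is invertible, then `B ^ (-1/2) * A ^ (1/2)` is a contraction. -/
theorem posSemidef_one_sub_posPow_neg_half_mul_posPow_half (hA : A.PosSemidef) (hB : B.PosDef)
    (hAB : (B - A).PosSemidef) :
    (1 - (posPow B (-(1 / 2)) * posPow A (1 / 2))ᴴ *
      (posPow B (-(1 / 2)) * posPow A (1 / 2))).PosSemidef := by
  apply posSemidef_one_sub_conjTranspose_mul_self
  have h := hAB.conjTranspose_mul_mul_same (posPow B (-(1 / 2)))
  have hB2 : posPow B (-(1 / 2)) * B * posPow B (-(1 / 2)) = 1 := by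
    nth_rw 2 [← posPow_one hB.1]
    rw [← hB.posPow_add, ← hB.posPow_add, ← posPow_zero hB.1]
    norm_num
  rw [(isHermitian_posPow hB.1 _).eq, mul_sub, sub_mul, hB2] at h
  convert h using 2
  rw [conjTranspose_mul, (isHermitian_posPow hB.1 _).eq, (isHermitian_posPow hA.1 _).eq]
  simp only [mul_assoc]
  rw [← mul_assoc (posPow A (1 / 2)), posPow_half_mul_self hA]

theorem trace_posPow_mul_mul_le (hA : A.PosSemidef) (hB : B.PosDef)
    (hAB : (B - A).PosSemidef) {r : ℝ} (hr : 0 < r) (hr1 : r < 1) :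
    (posPow B (-((1 - r) / 2)) * A * posPow B (-((1 - r) / 2))).trace.re ≤
      (posPow A r).trace.re := by
  have h := posSemidef_one_sub_posPow_neg_half_mul_posPow_half (hA.posPow (1 - r)) (hB.posPow (1 - r))
    (posSemidef_posPow_sub_posPow hA hAB ⟨by linarith, by linarith⟩)
  refine le_of_eq_of_le ?_ (trace_mul_mul_conjTranspose_re_le h (hA.posPow r))
  rw [conjTranspose_mul, posPow_posPow hA, posPow_posPow hB.posSemidef,
    (isHermitian_posPow hB.1 _).eq, (isHermitian_posPow hA.1 _).eq]
  have hA' : A = posPow A ((1 - r) * (1 / 2)) * posPow A r * posPow A ((1 - r) * (1 / 2)) := by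
    rw [← posPow_add hA (by linarith) hr.le, ← posPow_add hA (by linarith) (by linarith)]
    ring_nf
    rw [posPow_one hA.1]
  have e : -((1 - r) / 2) = (1 - r) * -(1 / 2) := by ring
  nth_rw 1 [hA']
  rw [e]
  simp only [mul_assoc]

/-- The Rotfeld trace inequality for the power function with exponent in `(0, 1)`. -/
theorem trace_posPow_add_le (hA : A.PosSemidef) (hB : B.PosSemidef) (hAB : (A + B).PosDef)
    {r : ℝ} (hr : 0 < r) (hr1 : r < 1) :
    (posPow (A + B) r).trace.re ≤ (posPow A r).trace.re + (posPow B r).trace.re := by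
  have h : posPow (A + B) r =
      posPow (A + B) (-((1 - r) / 2)) * (A + B) * posPow (A + B) (-((1 - r) / 2)) := by
    nth_rw 3 [← posPow_one hAB.1]
    rw [← hAB.posPow_add, ← hAB.posPow_add]
    ring_nf
  rw [h, mul_add, add_mul, trace_add, Complex.add_re]
  exact add_le_add (trace_posPow_mul_mul_le hA hAB (by simpa using hB) hr hr1)
    (trace_posPow_mul_mul_le hB hAB (by simpa using hA) hr hr1)

theorem trace_conjTranspose_mul_self_re {ι : Type*} [Fintype ι] (y : Matrix ι ι ℂ) :
    (yᴴ * y).trace.re = ∑ i, ∑ j, ‖y i j‖ ^ 2 := by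
  rw [Finset.sum_comm]
  simp [trace, mul_apply, Complex.sq_norm, Complex.normSq_apply]

theorem trace_conjTranspose_mul_self_conj (U : unitaryGroup ι ℂ) (y : Matrix ι ι ℂ) :
    (((U : Matrix ι ι ℂ) * y * (U : Matrix ι ι ℂ)ᴴ)ᴴ *
      ((U : Matrix ι ι ℂ) * y * (U : Matrix ι ι ℂ)ᴴ)).trace = (yᴴ * y).trace := by
  have hU : (U : Matrix ι ι ℂ)ᴴ * U = 1 := mem_unitaryGroup_iff'.1 U.2
  simp only [conjTranspose_mul, conjTranspose_conjTranspose]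
  rw [trace_mul_comm]
  simp only [mul_assoc]
  rw [← mul_assoc (U : Matrix ι ι ℂ)ᴴ U, hU, one_mul, trace_mul_comm]
  simp only [mul_assoc]
  rw [hU, mul_one, trace_mul_comm]

theorem norm_sq_weighted_le {s t : ℝ} (hs : 0 < s) (ht : 0 < t) (a b : ℂ) :
    ‖((s : ℂ) * a + t * b) / (s + t)‖ ^ 2 ≤ ‖a‖ ^ 2 + ‖b‖ ^ 2 := by
  have hst : ‖(s + t : ℂ)‖ = s + t := by
    rw [← Complex.ofReal_add, Complex.norm_real, Real.norm_of_nonneg (by positivity)]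
  have h : ‖(s : ℂ) * a + t * b‖ ≤ s * ‖a‖ + t * ‖b‖ := by
    refine (norm_add_le _ _).trans_eq ?_
    simp [abs_of_pos hs, abs_of_pos ht]
  rw [norm_div, hst, div_pow, div_le_iff₀ (by positivity)]
  refine (pow_le_pow_left₀ (norm_nonneg _) h 2).trans ?_
  nlinarith [sq_nonneg (s * ‖b‖ - t * ‖a‖), mul_nonneg (mul_pos hs ht).le (sq_nonneg ‖a‖),
    mul_nonneg (mul_pos hs ht).le (sq_nonneg ‖b‖)]

theorem PosDef.exists_mul_add_mul_eq {h : Matrix ι ι ℂ} (hh : h.PosDef) (a b : Matrix ι ι ℂ) :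
    ∃ y : Matrix ι ι ℂ, h * y + y * h = h * a + b * h ∧
      (yᴴ * y).trace.re ≤ (aᴴ * a).trace.re + (bᴴ * b).trace.re := by
  set U := hh.1.eigenvectorUnitary with hUdef
  set l := hh.1.eigenvalues with hl
  have hpos : ∀ i, 0 < l i := hh.eigenvalues_pos
  have hU : (U : Matrix ι ι ℂ)ᴴ * U = 1 := mem_unitaryGroup_iff'.1 U.2
  have hU' : (U : Matrix ι ι ℂ) * (U : Matrix ι ι ℂ)ᴴ = 1 := mem_unitaryGroup_iff.1 U.2
  have hspec : h = U * diagonal (fun i => (l i : ℂ)) * (U : Matrix ι ι ℂ)ᴴ := by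
    conv_lhs => rw [hh.1.spectral_theorem]
    rfl
  have hconj : ∀ m : Matrix ι ι ℂ, ∃ m', m = U * m' * (U : Matrix ι ι ℂ)ᴴ := fun m =>
    ⟨(U : Matrix ι ι ℂ)ᴴ * m * U, by
      simp only [mul_assoc, hU', mul_one]
      rw [← mul_assoc, hU', one_mul]⟩
  have hmul : ∀ m m' : Matrix ι ι ℂ, (U * m * (U : Matrix ι ι ℂ)ᴴ) * (U * m' * (U : Matrix ι ι ℂ)ᴴ)
      = U * (m * m') * (U : Matrix ι ι ℂ)ᴴ := fun m m' => by
    simp only [mul_assoc]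
    rw [← mul_assoc (U : Matrix ι ι ℂ)ᴴ U, hU, one_mul]
  obtain ⟨a, rfl⟩ := hconj a
  obtain ⟨b, rfl⟩ := hconj b
  refine ⟨U * of (fun i j => ((l i : ℂ) * a i j + l j * b i j) / (l i + l j)) *
    (U : Matrix ι ι ℂ)ᴴ, ?_, ?_⟩
  · rw [hspec]
    simp only [hmul, ← add_mul, ← mul_add]
    congr 2
    ext i j
    have : (l i + l j : ℂ) ≠ 0 := by
      exact_mod_cast (add_pos (hpos i) (hpos j)).ne'
    simp only [add_apply, diagonal_mul, mul_diagonal, of_apply]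
    field_simp
  · simp only [trace_conjTranspose_mul_self_conj, trace_conjTranspose_mul_self_re,
      ← Finset.sum_add_distrib]
    exact Finset.sum_le_sum fun i _ => Finset.sum_le_sum fun j _ =>
      norm_sq_weighted_le (hpos i) (hpos j) _ _

theorem schattenNorm_two (y : Matrix ι ι ℂ) :
    schattenNorm 2 y = √((yᴴ * y).trace.re) := by
  rw [schattenNorm, div_self two_ne_zero, posPow_one (isHermitian_conjTranspose_mul_self y),
    Real.sqrt_eq_rpow]

theorem exists_posPow_half_mul_add_mul_eq (hA : A.PosSemidef) (hB : B.PosDef)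
    (hAB : (B - A).PosSemidef) (y : Matrix ι ι ℂ) :
    ∃ y' : Matrix ι ι ℂ,
      posPow A (1 / 2) * y + y * posPow A (1 / 2) =
        posPow B (1 / 2) * y' + y' * posPow B (1 / 2) ∧
      schattenNorm 2 y' ≤ 2 * schattenNorm 2 y := by
  have hX := posSemidef_one_sub_posPow_neg_half_mul_posPow_half hA hB hAB
  set X := posPow B (-(1 / 2)) * posPow A (1 / 2) with hXdef
  have hBX : posPow B (1 / 2) * X = posPow A (1 / 2) := by
    rw [hXdef, ← mul_assoc, ← hB.posPow_add, add_neg_cancel, posPow_zero hB.1, one_mul]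
  have hXB : Xᴴ * posPow B (1 / 2) = posPow A (1 / 2) := by
    simpa [conjTranspose_mul, (isHermitian_posPow hB.1 _).eq, (isHermitian_posPow hA.1 _).eq]
      using congrArg conjTranspose hBX
  obtain ⟨y', hy', hle⟩ := (hB.posPow (1 / 2)).exists_mul_add_mul_eq (X * y) (y * Xᴴ)
  refine ⟨y', by rw [hy', ← mul_assoc, mul_assoc y, hBX, hXB], ?_⟩
  have h0 : 0 ≤ (yᴴ * y).trace.re := by
    rw [trace_conjTranspose_mul_self_re]
    positivity
  have h1 : ((X * y)ᴴ * (X * y)).trace.re ≤ (yᴴ * y).trace.re := by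
    rw [trace_mul_comm, trace_mul_comm yᴴ]
    simpa [conjTranspose_mul, mul_assoc] using
      trace_mul_mul_conjTranspose_re_le hX (posSemidef_self_mul_conjTranspose y)
  have h2 : ((y * Xᴴ)ᴴ * (y * Xᴴ)).trace.re ≤ (yᴴ * y).trace.re := by
    simpa [conjTranspose_mul, mul_assoc] using
      trace_mul_mul_conjTranspose_re_le hX (posSemidef_conjTranspose_mul_self y)
  rw [schattenNorm_two, schattenNorm_two, Real.sqrt_le_left (by positivity), mul_pow,
    Real.sq_sqrt h0]
  linarith

end Matrix

/-- Lemma 4.2, matrix version. -/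
theorem statement14 (p α : ℝ) (hp0 : 0 < p) (hp1 : p < 1) (hα : α = 1/p - 1/2)
    (n : ℕ) (f f₀ g : Matrix (Fin n) (Fin n) ℂ)
    (hf : f.PosSemidef) (hf₀ : f₀.PosDef) (htf : f.trace = 1) (htf₀ : f₀.trace = 1)
    (hg : g = posPow (posPow f (2*α) + posPow f₀ (2*α)) (1/(2*α))) :
    g.PosDef ∧ g.trace.re ≤ 2 ∧
    ∀ y : Matrix (Fin n) (Fin n) ℂ, ∃ y' : Matrix (Fin n) (Fin n) ℂ,
      (1/2 : ℂ) • (posPow f α * y + y * posPow f α) =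
        (1/2 : ℂ) • (posPow g α * y' + y' * posPow g α) ∧
      schattenNorm 2 y' ≤ 2 * schattenNorm 2 y := by
  have hα0 : 1 / 2 < α := by
    have : 1 < 1 / p := by rwa [lt_div_iff₀ hp0, one_mul]
    linarith
  have h2α : 2 * α * (1 / (2 * α)) = 1 := mul_one_div_cancel (by linarith)
  have hA : (posPow f (2 * α)).PosSemidef := hf.posPow _
  have hB : (posPow f₀ (2 * α)).PosDef := hf₀.posPow _
  have hAB : (posPow f (2 * α) + posPow f₀ (2 * α)).PosDef := hB.posSemidef_add hA
  have hfα : posPow f α = posPow (posPow f (2 * α)) (1 / 2) := by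
    rw [posPow_posPow hf]
    ring_nf
  have hgα : posPow g α = posPow (posPow f (2 * α) + posPow f₀ (2 * α)) (1 / 2) := by
    rw [hg, posPow_posPow hAB.posSemidef]
    congr 1
    field_simp
  refine ⟨hg ▸ hAB.posPow _, ?_, fun y => ?_⟩
  · have h := trace_posPow_add_le hA hB.posSemidef hAB (r := 1 / (2 * α)) (by positivity)
      (by rw [div_lt_one] <;> linarith)
    rw [← hg, posPow_posPow hf, posPow_posPow hf₀.posSemidef, h2α, posPow_one hf.1,
      posPow_one hf₀.1, htf, htf₀] at h
    norm_num at h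
    exact h
  · obtain ⟨y', hy', hle⟩ := exists_posPow_half_mul_add_mul_eq hA hAB
      (by simpa using hB.posSemidef) y
    exact ⟨y', by rw [hfα, hgα, hy'], hle⟩
end
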